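/- arXiv:math/9810012 — 2 statements merged into one kernel-verified Lean document; each statement's English description precedes it below -/
import Mathlib

section
/- For every m ≥ 2 and n ≥ 1, rat(n,m) is contained in a single path component C of Ω ℝP^m, and the inclusion rat(n,m) ↪ C induces, for any basepoint in rat(n,m), a bijection on homotopy groups π_k for all k < n(m−1) and a surjection on π_{n(m−1)}. -/
open OnePoint Projectivization

noncomputable section

/-- Real projective `m`-space, the projectivization of `ℝ^{m+1}`. -/
abbrev RP (m : ℕ) := Projectivization ℝ (Fin (m + 1) → ℝ)

instance (m : ℕ) : TopologicalSpace (RP m) :=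
  inferInstanceAs (TopologicalSpace (Quotient _))

/-- The basepoint `[1 : 1 : ⋯ : 1]` of `ℝP^m`. -/
def basept (m : ℕ) : RP m :=
  Projectivization.mk ℝ (fun _ => (1 : ℝ)) (by
    intro h
    exact one_ne_zero (congrFun h 0))

/-- The based loop space `Ω ℝP^m`: continuous maps `ℝP¹ = ℝ ∪ {∞} → ℝP^m`
sending `∞` to the basepoint, with the compact-open topology. -/
abbrev OmegaRP (m : ℕ) := {f : C(OnePoint ℝ, RP m) // f ∞ = basept m}

/-- The set of based loops arising from `(m+1)`-tuples of monic real polynomials of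
degree `n` with no common complex root. -/
def RRat (n m : ℕ) : Set (OmegaRP m) :=
  {f | ∃ p : Fin (m + 1) → Polynomial ℝ,
    (∀ i, (p i).Monic) ∧ (∀ i, (p i).natDegree = n) ∧
    (∀ z : ℂ, ∃ i, Polynomial.aeval z (p i) ≠ 0) ∧
    ∀ x : ℝ, ∃ hx : (fun i => (p i).eval x) ≠ 0,
      f.1 (x : OnePoint ℝ) = Projectivization.mk ℝ (fun i => (p i).eval x) hx}

/-- `rat n m` is the closure of `RRat n m` in `Ω ℝP^m`. -/
def ratSet (n m : ℕ) : Set (OmegaRP m) := closure (RRat n m)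


open scoped Topology Topology.Homotopy

/-- The map on `k`-th homotopy groups induced by a continuous map `g`, obtained by
composing generalized loops with `g`. -/
def piMap {X Y : Type*} [TopologicalSpace X] [TopologicalSpace Y]
    (g : C(X, Y)) (x : X) (k : ℕ) :
    HomotopyGroup (Fin k) X x → HomotopyGroup (Fin k) Y (g x) :=
  Quotient.map (sa := GenLoop.Homotopic.setoid (Fin k) x)
    (sb := GenLoop.Homotopic.setoid (Fin k) (g x))
    (fun f => ⟨g.comp f.1, fun y hy => by
      rw [ContinuousMap.comp_apply, f.2 y hy]⟩)
    (fun f₁ f₂ h => h.map fun F => F.compContinuousMap g)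

namespace RatLoop

open scoped unitInterval

/-- First homogeneous coordinate of the parametrization of `ℝP¹` by the unit interval. -/
def numer (t : I) : ℝ := 1 - 2 * t

/-- Second homogeneous coordinate of the parametrization of `ℝP¹` by the unit interval. -/
def denom (t : I) : ℝ := t * (1 - t)

@[fun_prop] lemma continuous_numer : Continuous numer := by unfold numer; fun_prop
@[fun_prop] lemma continuous_denom : Continuous denom := by unfold denom; fun_prop
@[simp] lemma numer_zero : numer 0 = 1 := by simp [numer]
@[simp] lemma numer_one : numer 1 = -1 := by norm_num [numer]
@[simp] lemma denom_zero : denom 0 = 0 := by simp [denom]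
@[simp] lemma denom_one : denom 1 = 0 := by simp [denom]

lemma denom_eq_zero_iff {t : I} : denom t = 0 ↔ t = 0 ∨ t = 1 := by
  unfold denom
  rw [mul_eq_zero, sub_eq_zero, eq_comm (a := (1 : ℝ))]
  exact or_congr (by rw [Subtype.ext_iff]; rfl) (by rw [Subtype.ext_iff]; rfl)

/-- The parametrization `t ↦ (1 - 2t) / (t (1 - t))` of `ℝ ∪ {∞}` by the unit interval. -/
def chart (t : I) : OnePoint ℝ :=
  if denom t = 0 then ∞ else ((numer t / denom t : ℝ) : OnePoint ℝ)

lemma chart_of_ne {t : I} (h : denom t ≠ 0) :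
    chart t = ((numer t / denom t : ℝ) : OnePoint ℝ) := if_neg h

@[simp] lemma chart_zero : chart 0 = ∞ := if_pos denom_zero
@[simp] lemma chart_one : chart 1 = ∞ := if_pos denom_one

lemma numer_ne_zero {t : I} (h : denom t = 0) : numer t ≠ 0 := by
  rcases denom_eq_zero_iff.1 h with rfl | rfl <;> simp

lemma continuous_chart : Continuous chart := by
  rw [continuous_iff_continuousAt]
  intro t
  by_cases h : denom t = 0
  · rw [ContinuousAt, show chart t = ∞ from if_pos h, Filter.Tendsto, OnePoint.le_nhds_infty]
    intro K _ hK
    obtain ⟨R, hR⟩ := hK.isBounded.exists_norm_le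
    have h1 : ∀ᶠ s in 𝓝 t, R * |denom s| < |numer s| :=
      ContinuousAt.eventually_lt (by fun_prop) (by fun_prop)
        (by rw [h, abs_zero, mul_zero]; exact abs_pos.2 (numer_ne_zero h))
    rw [Filter.mem_map]
    filter_upwards [h1] with s hs
    by_cases hd : denom s = 0
    · exact Or.inr (if_pos hd)
    · refine Or.inl ⟨numer s / denom s, fun hmem => ?_, (chart_of_ne hd).symm⟩
      have := hR _ hmem
      rw [Real.norm_eq_abs, abs_div, div_le_iff₀ (abs_pos.2 hd)] at this
      exact absurd hs this.not_gt
  · have h1 : ∀ᶠ s in 𝓝 t, denom s ≠ 0 := continuous_denom.continuousAt.eventually_ne h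
    have h2 : ContinuousAt (fun s => ((numer s / denom s : ℝ) : OnePoint ℝ)) t :=
      OnePoint.continuous_coe.continuousAt.comp
        (continuous_numer.continuousAt.div continuous_denom.continuousAt h)
    exact h2.congr (h1.mono fun s hs => (chart_of_ne hs).symm)

lemma surjective_chart : Function.Surjective chart := by
  intro x
  induction x using OnePoint.rec with
  | infty => exact ⟨0, chart_zero⟩
  | coe x =>
    obtain ⟨t, ht⟩ : ∃ t : I, numer t - x * denom t = 0 := by
      have hc : Continuous fun t : I => numer t - x * denom t := by fun_prop
      exact mem_range_of_exists_le_of_exists_ge hc ⟨1, by simp⟩ ⟨0, by simp⟩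
    have hd : denom t ≠ 0 := fun h => numer_ne_zero h (by simpa [h] using ht)
    refine ⟨t, ?_⟩
    rw [chart_of_ne hd, sub_eq_zero.1 ht, mul_div_assoc, div_self hd, mul_one]

lemma ratio_injective {s t : I} (hs : denom s ≠ 0) (ht : denom t ≠ 0)
    (h : numer s / denom s = numer t / denom t) : s = t := by
  rw [div_eq_div_iff hs ht] at h
  rw [Ne, denom_eq_zero_iff, not_or] at hs ht
  have hs0 : 0 < (s : ℝ) := lt_of_le_of_ne s.2.1 (fun h => hs.1 (Subtype.ext h.symm))
  have ht0 : 0 < (t : ℝ) := lt_of_le_of_ne t.2.1 (fun h => ht.1 (Subtype.ext h.symm))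
  have key : ((s : ℝ) - t) * ((1 - s) * (1 - t) + s * t) = 0 := by
    unfold numer denom at h; linear_combination -h
  have hpos : 0 < (1 - (s : ℝ)) * (1 - t) + s * t :=
    add_pos_of_nonneg_of_pos (mul_nonneg (sub_nonneg.2 s.2.2) (sub_nonneg.2 t.2.2)) (mul_pos hs0 ht0)
  exact Subtype.ext (sub_eq_zero.1 ((mul_eq_zero.1 key).resolve_right hpos.ne'))

variable {m : ℕ}

/-- The class in `ℝP^m` of a vector (the basepoint for the zero vector). -/
def proj (v : Fin (m + 1) → ℝ) : RP m :=
  open Classical in if h : v ≠ 0 then Projectivization.mk ℝ v h else basept m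

lemma proj_of_ne {v : Fin (m + 1) → ℝ} (h : v ≠ 0) : proj v = Projectivization.mk ℝ v h := dif_pos h

lemma proj_one : proj (1 : Fin (m + 1) → ℝ) = basept m := proj_of_ne one_ne_zero

lemma proj_smul {c : ℝ} (hc : c ≠ 0) (v : Fin (m + 1) → ℝ) : proj (c • v) = proj v := by
  by_cases h : v = 0
  · simp [h]
  · rw [proj_of_ne h, proj_of_ne (smul_ne_zero hc h)]
    exact (Projectivization.mk_eq_mk_iff' ℝ _ _ _ _).2 ⟨c, rfl⟩

lemma proj_eq_proj {v w : Fin (m + 1) → ℝ} (hv : v ≠ 0) (hw : w ≠ 0) (h : proj v = proj w) :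
    ∃ c : ℝ, c ≠ 0 ∧ v = c • w := by
  rw [proj_of_ne hv, proj_of_ne hw] at h
  obtain ⟨c, hc⟩ := (Projectivization.mk_eq_mk_iff' ℝ _ _ _ _).1 h
  refine ⟨c, ?_, hc.symm⟩
  rintro rfl
  exact hv (by rw [← hc, zero_smul])

lemma isQuotientMap_mk' :
    Topology.IsQuotientMap (fun v : {v : Fin (m + 1) → ℝ // v ≠ 0} => Projectivization.mk ℝ v.1 v.2) :=
  isQuotientMap_quotient_mk'

lemma continuous_proj {T : Type*} [TopologicalSpace T] {F : T → Fin (m + 1) → ℝ}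
    (hF : Continuous F) (h0 : ∀ s, F s ≠ 0) : Continuous fun s => proj (F s) := by
  have : (fun s => proj (F s)) =
      (fun v : {v : Fin (m + 1) → ℝ // v ≠ 0} => Projectivization.mk ℝ v.1 v.2) ∘
        fun s => ⟨F s, h0 s⟩ := funext fun s => proj_of_ne (h0 s)
  rw [this]
  exact isQuotientMap_mk'.continuous.comp (hF.subtype_mk h0)

/-- The two-fold covering of `ℝP^m` by the unit sphere (of the sup norm). -/
def sphereProj (v : Metric.sphere (0 : Fin (m + 1) → ℝ) 1) : RP m := proj v.1

lemma sphere_ne_zero (v : Metric.sphere (0 : Fin (m + 1) → ℝ) 1) : v.1 ≠ 0 :=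
  ne_zero_of_mem_unit_sphere v

lemma isCoveringMap_sphereProj : IsCoveringMap (sphereProj (m := m)) := by
  have hcont : Continuous (sphereProj (m := m)) :=
    continuous_proj continuous_subtype_val sphere_ne_zero
  have hq : Topology.IsQuotientMap (sphereProj (m := m)) := by
    let N : {v : Fin (m + 1) → ℝ // v ≠ 0} → Metric.sphere (0 : Fin (m + 1) → ℝ) 1 :=
      fun v => ⟨‖v.1‖⁻¹ • v.1, by
        rw [mem_sphere_zero_iff_norm, norm_smul, norm_inv, norm_norm,
          inv_mul_cancel₀ (norm_ne_zero_iff.2 v.2)]⟩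
    have hN : Continuous N := by
      refine Continuous.subtype_mk ?_ _
      exact (continuous_subtype_val.norm.inv₀ fun v => norm_ne_zero_iff.2 v.2).smul
        continuous_subtype_val
    refine Topology.IsQuotientMap.of_comp hN hcont ?_
    have : sphereProj ∘ N =
        (fun v : {v : Fin (m + 1) → ℝ // v ≠ 0} => Projectivization.mk ℝ v.1 v.2) := by
      funext v
      change proj (‖v.1‖⁻¹ • v.1) = _
      rw [proj_smul (inv_ne_zero (norm_ne_zero_iff.2 v.2)), proj_of_ne v.2]
    rw [this]
    exact isQuotientMap_mk'
  have hG : IsQuotientCoveringMap (sphereProj (m := m)) (Metric.sphere (0 : ℝ) 1) :=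
    { hq with
      continuous_const_smul := fun g => by
        refine Continuous.subtype_mk ?_ _
        exact continuous_subtype_val.const_smul g.1
      apply_eq_iff_mem_orbit := by
        intro v w
        constructor
        · intro h
          obtain ⟨c, -, hc⟩ := proj_eq_proj (sphere_ne_zero v) (sphere_ne_zero w) h
          have h1 : ‖c‖ = 1 := by
            have := congrArg norm hc
            rw [norm_smul, mem_sphere_zero_iff_norm.1 v.2, mem_sphere_zero_iff_norm.1 w.2] at this
            linarith
          exact ⟨⟨c, mem_sphere_zero_iff_norm.2 h1⟩, Subtype.ext hc.symm⟩
        · rintro ⟨g, rfl⟩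
          exact proj_smul (ne_zero_of_mem_unit_sphere g) w.1
      disjoint := by
        intro e
        refine ⟨Metric.ball e 1, Metric.ball_mem_nhds e one_pos, ?_⟩
        rintro ⟨g, hg⟩ ⟨y, ⟨x, hx, rfl⟩, hy⟩
        rw [mem_sphere_zero_iff_norm, Real.norm_eq_abs] at hg
        rcases (abs_eq zero_le_one).1 hg with rfl | rfl
        · rfl
        · exfalso
          have hx' : ‖x.1 - e.1‖ < 1 := by simpa [dist_eq_norm, Subtype.dist_eq] using hx
          have hy' : ‖(-1 : ℝ) • x.1 - e.1‖ < 1 := by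
            rw [← dist_eq_norm]
            exact hy
          have h2 : ‖(2 : ℝ) • e.1‖ = 2 := by
            rw [norm_smul, mem_sphere_zero_iff_norm.1 e.2]; norm_num
          have h3 : (2 : ℝ) • e.1 = -((x.1 - e.1) + ((-1 : ℝ) • x.1 - e.1)) := by module
          have := norm_add_le (x.1 - e.1) ((-1 : ℝ) • x.1 - e.1)
          rw [h3, norm_neg] at h2
          linarith }
  exact hG.isCoveringMap

lemma omega_ext {ℓ ℓ' : OmegaRP m} (h : ∀ t, ℓ.1 (chart t) = ℓ'.1 (chart t)) : ℓ = ℓ' := by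
  refine Subtype.ext (ContinuousMap.ext fun x => ?_)
  obtain ⟨t, rfl⟩ := surjective_chart x
  exact h t

/-- Continuous families of nowhere vanishing paths in `ℝ^{m+1}` from `(1, …, 1)` to
`(-1)^n (1, …, 1)`; such paths represent based loops in `ℝP^m`. -/
structure IsFamily (n : ℕ) {T : Type*} [TopologicalSpace T] (F : T → I → Fin (m + 1) → ℝ) :
    Prop where
  continuous : Continuous fun p : T × I => F p.1 p.2
  ne_zero : ∀ s t, F s t ≠ 0
  map_zero : ∀ s, F s 0 = 1
  map_one : ∀ s, F s 1 = (-1 : ℝ) ^ n • 1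

section Families

variable {n : ℕ} {T : Type*} [TopologicalSpace T] {F : T → I → Fin (m + 1) → ℝ}

lemma IsFamily.exists_loops (hF : IsFamily n F) :
    ∃ γ : C(T, OmegaRP m), ∀ s t, (γ s).1 (chart t) = proj (F s t) := by
  let q : C(T × I, T × OnePoint ℝ) := ⟨Prod.map id chart, continuous_id.prodMap continuous_chart⟩
  have hq : Topology.IsQuotientMap q :=
    (isProperMap_id.prodMap continuous_chart.isProperMap).isClosedMap.isQuotientMap q.continuous
      (Function.surjective_id.prodMap surjective_chart)
  let P : C(T × I, RP m) :=
    ⟨fun p => proj (F p.1 p.2), continuous_proj hF.continuous fun p => hF.ne_zero p.1 p.2⟩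
  have h01 : ∀ s, proj (F s 1) = proj (F s 0) := fun s => by
    rw [hF.map_zero, hF.map_one, proj_smul (pow_ne_zero _ (by norm_num))]
  have hchart : ∀ t t' : I, chart t = chart t' → denom t ≠ 0 → t = t' := by
    intro t t' h hd
    rw [chart_of_ne hd] at h
    by_cases hd' : denom t' = 0
    · rw [chart, if_pos hd'] at h
      exact absurd h (OnePoint.coe_ne_infty _)
    · rw [chart_of_ne hd', OnePoint.coe_eq_coe] at h
      exact ratio_injective hd hd' h
  have hfac : Function.FactorsThrough P q := by
    rintro ⟨s, t⟩ ⟨s', t'⟩ h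
    obtain ⟨rfl, h'⟩ : s = s' ∧ chart t = chart t' := Prod.ext_iff.1 h
    change proj (F s t) = proj (F s t')
    by_cases hd : denom t = 0
    · by_cases hd' : denom t' = 0
      · rcases denom_eq_zero_iff.1 hd with rfl | rfl <;>
          rcases denom_eq_zero_iff.1 hd' with rfl | rfl <;> simp [h01]
      · rw [hchart t' t h'.symm hd']
    · rw [hchart t t' h' hd]
  let G : C(T × OnePoint ℝ, RP m) := hq.lift P hfac
  have hG : ∀ s t, G (s, chart t) = proj (F s t) := fun s t =>
    DFunLike.congr_fun (hq.lift_comp P hfac) (s, t)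
  refine ⟨⟨fun s => ⟨G.curry s, ?_⟩, ?_⟩, hG⟩
  · rw [← chart_zero, ContinuousMap.curry_apply, hG, hF.map_zero, proj_one]
  · exact G.curry.continuous.subtype_mk _

/-- The family of loops represented by a family of paths. -/
def IsFamily.loops (hF : IsFamily n F) : C(T, OmegaRP m) := hF.exists_loops.choose

lemma IsFamily.loops_apply (hF : IsFamily n F) (s : T) (t : I) :
    (hF.loops s).1 (chart t) = proj (F s t) := hF.exists_loops.choose_spec s t

lemma IsFamily.comp (hF : IsFamily n F) {T' : Type*} [TopologicalSpace T'] {φ : T' → T}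
    (hφ : Continuous φ) : IsFamily n fun s => F (φ s) where
  continuous := hF.continuous.comp (hφ.prodMap continuous_id)
  ne_zero _ _ := hF.ne_zero _ _
  map_zero _ := hF.map_zero _
  map_one _ := hF.map_one _

end Families

/-- Evaluation of loops along the parametrization of `ℝP¹`. -/
def evalMap (m : ℕ) : C(I × OmegaRP m, RP m) where
  toFun p := p.2.1 (chart p.1)
  continuous_toFun :=
    ContinuousEval.continuous_eval.comp
      ((continuous_subtype_val.comp continuous_snd).prodMk (continuous_chart.comp continuous_fst))

/-- The lift of all loops to the sphere. -/
def liftMap (m : ℕ) : C(I × OmegaRP m, Metric.sphere (0 : Fin (m + 1) → ℝ) 1) :=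
  isCoveringMap_sphereProj.liftHomotopy (evalMap m) (.const _ ⟨1, by simp⟩) fun ℓ => by
    change ℓ.1 (chart 0) = proj 1
    rw [chart_zero, ℓ.2, proj_one]

/-- The lift of a loop to a path in the sphere starting at `(1, …, 1)`. -/
def lift (ℓ : OmegaRP m) (t : I) : Fin (m + 1) → ℝ := (liftMap m (t, ℓ)).1

lemma continuous_lift : Continuous fun p : OmegaRP m × I => lift p.1 p.2 :=
  continuous_subtype_val.comp ((liftMap m).continuous.comp continuous_swap)

@[simp] lemma norm_lift (ℓ : OmegaRP m) (t : I) : ‖lift ℓ t‖ = 1 :=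
  mem_sphere_zero_iff_norm.1 (liftMap m (t, ℓ)).2

lemma lift_ne_zero (ℓ : OmegaRP m) (t : I) : lift ℓ t ≠ 0 := sphere_ne_zero _

@[simp] lemma lift_zero (ℓ : OmegaRP m) : lift ℓ 0 = 1 :=
  congrArg Subtype.val (isCoveringMap_sphereProj.liftHomotopy_zero (evalMap m) _ _ ℓ)

lemma proj_lift (ℓ : OmegaRP m) (t : I) : proj (lift ℓ t) = ℓ.1 (chart t) :=
  congrFun (isCoveringMap_sphereProj.liftHomotopy_lifts (evalMap m) _ _) (t, ℓ)

lemma lift_one (ℓ : OmegaRP m) : lift ℓ 1 = 1 ∨ lift ℓ 1 = -1 := by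
  have h : proj (lift ℓ 1) = proj 1 := by rw [proj_lift, chart_one, ℓ.2, proj_one]
  obtain ⟨c, -, hc⟩ := proj_eq_proj (lift_ne_zero ℓ 1) one_ne_zero h
  have hn := congrArg norm hc
  rw [norm_lift, norm_smul, norm_one, mul_one, Real.norm_eq_abs, eq_comm] at hn
  rw [hc]
  rcases (abs_eq zero_le_one).1 hn with rfl | rfl <;> simp

lemma lift_eq {ℓ : OmegaRP m} {F : I → Fin (m + 1) → ℝ} (hc : Continuous F) (h0 : ∀ t, F t ≠ 0)
    (h1 : F 0 = 1) (h : ∀ t, ℓ.1 (chart t) = proj (F t)) (t : I) :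
    lift ℓ t = ‖F t‖⁻¹ • F t := by
  let g : I → Metric.sphere (0 : Fin (m + 1) → ℝ) 1 := fun t => ⟨‖F t‖⁻¹ • F t, by
    rw [mem_sphere_zero_iff_norm, norm_smul, norm_inv, norm_norm,
      inv_mul_cancel₀ (norm_ne_zero_iff.2 (h0 t))]⟩
  have hg : Continuous g :=
    ((hc.norm.inv₀ fun t => norm_ne_zero_iff.2 (h0 t)).smul hc).subtype_mk _
  have hl : Continuous fun t => liftMap m (t, ℓ) := by fun_prop
  have key := isCoveringMap_sphereProj.eq_of_comp_eq hl hg (funext fun t => ?_) 0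
    (Subtype.ext ?_)
  · exact congrArg Subtype.val (congrFun key t)
  · change proj (lift ℓ t) = proj (‖F t‖⁻¹ • F t)
    rw [proj_lift, proj_smul (inv_ne_zero (norm_ne_zero_iff.2 (h0 t))), h]
  · change lift ℓ 0 = ‖F 0‖⁻¹ • F 0
    simp [h1]

/-- The loops whose lift to the sphere ends at `(-1)^n (1, …, 1)`. -/
def signLoops (n m : ℕ) : Set (OmegaRP m) := {ℓ | lift ℓ 1 = (-1 : ℝ) ^ n • 1}

lemma isClopen_signLoops (n : ℕ) : IsClopen (signLoops n m) := by
  have hl : Continuous fun ℓ : OmegaRP m => lift ℓ 1 :=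
    continuous_lift.comp (Continuous.prodMk_left (1 : I))
  refine ⟨isClosed_eq hl continuous_const, ?_⟩
  have : (signLoops n m)ᶜ = {ℓ | lift ℓ 1 = -(-1 : ℝ) ^ n • 1} := by
    have h11 : (1 : Fin (m + 1) → ℝ) ≠ -1 := fun h => by
      have := congrFun h 0
      norm_num at this
    ext ℓ
    rcases lift_one ℓ with h | h <;> rcases neg_one_pow_eq_or ℝ n with h' | h' <;>
      simp [signLoops, h, h', h11, h11.symm]
  rw [← isClosed_compl_iff, this]
  exact isClosed_eq hl continuous_const

lemma isFamily_lift {n : ℕ} {T : Type*} [TopologicalSpace T] {γ : C(T, OmegaRP m)}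
    (h : ∀ s, γ s ∈ signLoops n m) : IsFamily n fun s => lift (γ s) where
  continuous := continuous_lift.comp (γ.continuous.prodMap continuous_id)
  ne_zero _ _ := lift_ne_zero _ _
  map_zero _ := lift_zero _
  map_one := h

lemma IsFamily.loops_eq {n : ℕ} {T : Type*} [TopologicalSpace T] {F : T → I → Fin (m + 1) → ℝ}
    (hF : IsFamily n F) {γ : C(T, OmegaRP m)} {s : T}
    (h : ∀ t, (γ s).1 (chart t) = proj (F s t)) : hF.loops s = γ s :=
  omega_ext fun t => by rw [hF.loops_apply, h]

section PolyPath

variable {n : ℕ}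

/-- The homogenization of degree `n - 1` of the polynomial with coefficients `c`. -/
def homog (c : Fin n → ℝ) (t : I) : ℝ :=
  ∑ i : Fin n, c i * (numer t ^ (i : ℕ) * denom t ^ (n - 1 - i : ℕ))

@[fun_prop] lemma continuous_homog {T : Type*} [TopologicalSpace T] {c : T → Fin n → ℝ} {τ : T → I}
    (hc : Continuous c) (hτ : Continuous τ) : Continuous fun s => homog (c s) (τ s) := by
  unfold homog
  fun_prop

lemma homog_add (c c' : Fin n → ℝ) (t : I) : homog (c + c') t = homog c t + homog c' t := by
  simp [homog, add_mul, Finset.sum_add_distrib]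

lemma homog_smul (a : ℝ) (c : Fin n → ℝ) (t : I) : homog (a • c) t = a * homog c t := by
  simp [homog, Finset.mul_sum, mul_assoc]

lemma denom_mul_homog (c : Fin n → ℝ) {t : I} (ht : denom t ≠ 0) :
    denom t * homog c t =
      denom t ^ n * (Polynomial.ofFn n c).eval (numer t / denom t) := by
  rw [Polynomial.ofFn_eq_sum_monomial, Polynomial.eval_finsetSum, homog, Finset.mul_sum,
    Finset.mul_sum]
  refine Finset.sum_congr rfl fun i _ => ?_
  obtain ⟨k, hk⟩ : ∃ k, n = i + k + 1 := ⟨n - 1 - i, by omega⟩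
  rw [Polynomial.eval_monomial, div_pow, show n - 1 - (i : ℕ) = k by omega]
  have hp : denom t ^ n = denom t ^ (i : ℕ) * denom t ^ k * denom t := by
    rw [← pow_add, ← pow_succ, ← hk]
  rw [hp]
  field_simp

/-- The leading coordinate of a polynomial path. -/
def lead (c : Fin n → ℝ) (t : I) : ℝ := numer t ^ n + denom t * homog c t

@[fun_prop] lemma continuous_lead {T : Type*} [TopologicalSpace T] {c : T → Fin n → ℝ} {τ : T → I}
    (hc : Continuous c) (hτ : Continuous τ) : Continuous fun s => lead (c s) (τ s) := by
  unfold lead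
  fun_prop

lemma lead_eq (c : Fin n → ℝ) {t : I} (ht : denom t ≠ 0) :
    lead c t = denom t ^ n *
      (Polynomial.X ^ n + Polynomial.ofFn n c).eval (numer t / denom t) := by
  rw [lead, denom_mul_homog c ht, Polynomial.eval_add, Polynomial.eval_pow, Polynomial.eval_X,
    div_pow, mul_add, mul_div_cancel₀ _ (pow_ne_zero _ ht)]

lemma lead_of_denom_eq_zero (c : Fin n → ℝ) {t : I} (ht : denom t = 0) :
    lead c t = numer t ^ n := by simp [lead, ht]

lemma monic_X_pow_add_ofFn (c : Fin n → ℝ) :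
    (Polynomial.X ^ n + Polynomial.ofFn n c).Monic :=
  Polynomial.monic_X_pow_add (Polynomial.ofFn_degree_lt c)

lemma natDegree_X_pow_add_ofFn (c : Fin n → ℝ) :
    (Polynomial.X ^ n + Polynomial.ofFn n c).natDegree = n :=
  Polynomial.natDegree_eq_of_degree_eq_some
    ((Polynomial.degree_add_eq_left_of_degree_lt
      (by rw [Polynomial.degree_X_pow]; exact Polynomial.ofFn_degree_lt c)).trans
        (Polynomial.degree_X_pow n))

/-- Real vectors in terms of their first coordinate and the differences to it. -/
def mkV (a : ℝ) (b : Fin m → ℝ) : Fin (m + 1) → ℝ := Fin.cons a fun i => a + b i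

@[simp] lemma mkV_zero (a : ℝ) (b : Fin m → ℝ) : mkV a b 0 = a := rfl
@[simp] lemma mkV_succ (a : ℝ) (b : Fin m → ℝ) (i : Fin m) : mkV a b i.succ = a + b i := rfl

lemma eq_mkV (v : Fin (m + 1) → ℝ) : v = mkV (v 0) fun i => v i.succ - v 0 := by
  ext i
  refine Fin.cases rfl (fun i => ?_) i
  simp

lemma mkV_eq_zero_iff {a : ℝ} {b : Fin m → ℝ} : mkV a b = 0 ↔ a = 0 ∧ b = 0 := by
  constructor
  · intro h
    obtain rfl : a = 0 := congrFun h 0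
    exact ⟨rfl, funext fun i => by simpa using congrFun h i.succ⟩
  · rintro ⟨rfl, rfl⟩
    ext i
    refine Fin.cases rfl (fun i => ?_) i
    simp

lemma mkV_smul_one (a : ℝ) : mkV a 0 = a • (1 : Fin (m + 1) → ℝ) := by
  ext i
  refine Fin.cases ?_ (fun i => ?_) i <;> simp

lemma mkV_add (a a' : ℝ) (b b' : Fin m → ℝ) : mkV (a + a') (b + b') = mkV a b + mkV a' b' := by
  ext i
  refine Fin.cases ?_ (fun i => ?_) i
  · simp
  · simp only [mkV_succ, Pi.add_apply]; ring

lemma smul_mkV (r a : ℝ) (b : Fin m → ℝ) : mkV (r * a) (r • b) = r • mkV a b := by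
  ext i
  refine Fin.cases ?_ (fun i => ?_) i
  · simp
  · simp only [mkV_succ, Pi.smul_apply, smul_eq_mul]; ring

@[fun_prop] lemma continuous_mkV {T : Type*} [TopologicalSpace T] {a : T → ℝ} {b : T → Fin m → ℝ}
    (ha : Continuous a) (hb : Continuous b) : Continuous fun s => mkV (a s) (b s) := by
  refine continuous_pi fun i => ?_
  refine Fin.cases ?_ (fun i => ?_) i
  · exact ha
  · simp only [mkV_succ]
    fun_prop

/-- The path in `ℝ^{m+1}` defined by the homogenization of the monic polynomials
`p₀ = X^n + c₀` and `pᵢ = p₀ + cᵢ`. -/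
def polyPath (c₀ : Fin n → ℝ) (c : Fin m → Fin n → ℝ) (t : I) : Fin (m + 1) → ℝ :=
  mkV (lead c₀ t) fun i => denom t * homog (c i) t

/-- The monic polynomials corresponding to a polynomial path. -/
def polys (c₀ : Fin n → ℝ) (c : Fin m → Fin n → ℝ) : Fin (m + 1) → Polynomial ℝ :=
  Fin.cons (Polynomial.X ^ n + Polynomial.ofFn n c₀)
    fun i => Polynomial.X ^ n + Polynomial.ofFn n (c₀ + c i)

lemma polyPath_eq (c₀ : Fin n → ℝ) (c : Fin m → Fin n → ℝ) {t : I} (ht : denom t ≠ 0) :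
    polyPath c₀ c t =
      denom t ^ n • fun i => (polys c₀ c i).eval (numer t / denom t) := by
  ext i
  refine Fin.cases ?_ (fun i => ?_) i
  · simp [polyPath, polys, lead_eq _ ht]
  · simp only [polyPath, mkV_succ, Pi.smul_apply, smul_eq_mul, polys, Fin.cons_succ, lead_eq _ ht,
      denom_mul_homog _ ht, map_add, Polynomial.eval_add]
    ring

lemma polyPath_of_denom_eq_zero (c₀ : Fin n → ℝ) (c : Fin m → Fin n → ℝ) {t : I}
    (ht : denom t = 0) : polyPath c₀ c t = numer t ^ n • 1 := by
  rw [← mkV_smul_one, polyPath, lead_of_denom_eq_zero _ ht]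
  congr 1
  ext i
  simp [ht]

lemma polyPath_ne_zero {c₀ : Fin n → ℝ} {c : Fin m → Fin n → ℝ}
    (h : ∀ x : ℝ, (fun i => (polys c₀ c i).eval x) ≠ 0) (t : I) : polyPath c₀ c t ≠ 0 := by
  by_cases ht : denom t = 0
  · rw [polyPath_of_denom_eq_zero _ _ ht]
    exact smul_ne_zero (pow_ne_zero _ (numer_ne_zero ht)) one_ne_zero
  · rw [polyPath_eq _ _ ht]
    exact smul_ne_zero (pow_ne_zero _ ht) (h _)

lemma continuous_polyPath {T : Type*} [TopologicalSpace T] {c₀ : T → Fin n → ℝ}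
    {c : T → Fin m → Fin n → ℝ} {τ : T → I} (hc₀ : Continuous c₀) (hc : Continuous c)
    (hτ : Continuous τ) : Continuous fun s => polyPath (c₀ s) (c s) (τ s) := by
  unfold polyPath
  fun_prop

lemma isFamily_polyPath {T : Type*} [TopologicalSpace T] {c₀ : T → Fin n → ℝ}
    {c : T → Fin m → Fin n → ℝ} (hc₀ : Continuous c₀) (hc : Continuous c)
    (h : ∀ s t, polyPath (c₀ s) (c s) t ≠ 0) :
    IsFamily n fun s => polyPath (c₀ s) (c s) where
  continuous := continuous_polyPath (hc₀.comp continuous_fst) (hc.comp continuous_fst)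
    continuous_snd
  ne_zero := h
  map_zero s := by rw [polyPath_of_denom_eq_zero _ _ denom_zero]; simp
  map_one s := by rw [polyPath_of_denom_eq_zero _ _ denom_one]; simp

lemma mem_RRat_of_polys {c₀ : Fin n → ℝ} {c : Fin m → Fin n → ℝ} {ℓ : OmegaRP m}
    (hroot : ∀ z : ℂ, ∃ i, Polynomial.aeval z (polys c₀ c i) ≠ 0)
    (hℓ : ∀ t, ℓ.1 (chart t) = proj (polyPath c₀ c t)) : ℓ ∈ RRat n m := by
  have hreal : ∀ x : ℝ, (fun i => (polys c₀ c i).eval x) ≠ 0 := by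
    intro x hx
    obtain ⟨i, hi⟩ := hroot x
    refine hi ?_
    have := Polynomial.aeval_algebraMap_apply_eq_algebraMap_eval (A := ℂ) x (polys c₀ c i)
    rw [congrFun hx i] at this
    simpa using this
  refine ⟨polys c₀ c, ?_, ?_, hroot, fun x => ⟨hreal x, ?_⟩⟩
  · exact fun i => Fin.cases (monic_X_pow_add_ofFn _) (fun _ => monic_X_pow_add_ofFn _) i
  · exact fun i => Fin.cases (natDegree_X_pow_add_ofFn _) (fun _ => natDegree_X_pow_add_ofFn _) i
  · obtain ⟨t, ht⟩ := surjective_chart x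
    have hd : denom t ≠ 0 := fun hd => by
      rw [chart, if_pos hd] at ht
      exact OnePoint.infty_ne_coe _ ht
    have hx : numer t / denom t = x := by
      rw [chart_of_ne hd] at ht
      exact OnePoint.coe_injective ht
    rw [← ht, hℓ, polyPath_eq _ _ hd, proj_smul (pow_ne_zero _ hd), hx, proj_of_ne (hreal x)]

end PolyPath

section Rat

variable {n : ℕ}

lemma ofFn_single_zero (hn : 0 < n) (e : ℝ) :
    Polynomial.ofFn n (Pi.single ⟨0, hn⟩ e) = Polynomial.C e := by
  rw [Polynomial.ofFn_eq_sum_monomial, Finset.sum_eq_single ⟨0, hn⟩]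
  · simp
  · intro i _ hi
    simp [Pi.single_eq_of_ne hi]
  · simp

lemma mem_ratSet_of_polyPath (hn : 1 ≤ n) (hm : 1 ≤ m) {c₀ : Fin n → ℝ} {c : Fin m → Fin n → ℝ}
    {ℓ : OmegaRP m} (h0 : ∀ t, polyPath c₀ c t ≠ 0)
    (hℓ : ∀ t, ℓ.1 (chart t) = proj (polyPath c₀ c t)) : ℓ ∈ ratSet n m := by
  let j : Fin m := ⟨0, hm⟩
  let c' : ℝ → Fin m → Fin n → ℝ := fun e => c + Pi.single j (Pi.single ⟨0, hn⟩ e)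
  have hc' : Continuous c' := by
    refine continuous_const.add ?_
    have h1 : Continuous fun e : ℝ => (Pi.single ⟨0, hn⟩ e : Fin n → ℝ) :=
      continuous_single (A := fun _ => ℝ) _
    exact (continuous_single (A := fun _ => Fin n → ℝ) j).comp h1
  have hc'0 : c' 0 = c := by simp [c']
  have hp0 : ∀ e, polys c₀ (c' e) 0 = polys c₀ c 0 := fun e => rfl
  have hp1 : ∀ e, polys c₀ (c' e) j.succ = polys c₀ c j.succ + Polynomial.C e := by
    intro e
    simp only [polys, Fin.cons_succ, c', Pi.add_apply, Pi.single_eq_same]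
    rw [← ofFn_single_zero hn e, ← add_assoc, map_add, add_assoc]
  have hP0 : polys c₀ c 0 ≠ 0 := (monic_X_pow_add_ofFn c₀).ne_zero
  let bad : Set ℝ := (fun e : ℝ => (e : ℂ)) ⁻¹'
    ((fun z => -Polynomial.aeval z (polys c₀ c j.succ)) '' (polys c₀ c 0).rootSet ℂ)
  have hbad : bad.Finite :=
    (((polys c₀ c 0).rootSet_finite ℂ).image _).preimage Complex.ofReal_injective.injOn
  have hgood : ∀ e ∉ bad, ∀ z : ℂ, ∃ i, Polynomial.aeval z (polys c₀ (c' e) i) ≠ 0 := by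
    intro e he z
    by_contra! hz
    refine he ⟨z, ?_, ?_⟩
    · rw [Polynomial.mem_rootSet]
      exact ⟨hP0, hp0 e ▸ hz 0⟩
    · have := hz j.succ
      rw [hp1, map_add, Polynomial.aeval_C] at this
      exact neg_eq_of_add_eq_zero_right this
  let T := {e : ℝ // e = 0 ∨ e ∉ bad}
  have hne : ∀ (e : T) t, polyPath c₀ (c' e.1) t ≠ 0 := by
    rintro ⟨e, rfl | he⟩
    · simpa only [hc'0] using h0
    · refine polyPath_ne_zero fun x hx => ?_
      obtain ⟨i, hi⟩ := hgood e he x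
      refine hi ?_
      have := Polynomial.aeval_algebraMap_apply_eq_algebraMap_eval (A := ℂ) x (polys c₀ (c' e) i)
      rw [congrFun hx i] at this
      simpa using this
  have hF : IsFamily n fun e : T => polyPath c₀ (c' e.1) :=
    isFamily_polyPath continuous_const (hc'.comp continuous_subtype_val) hne
  have h00 : hF.loops ⟨0, Or.inl rfl⟩ = ℓ :=
    omega_ext fun t => by rw [hF.loops_apply, hℓ]; simp only [hc'0]
  rw [← h00]
  refine map_mem_closure hF.loops.continuous (s := {e : T | e.1 ∉ bad}) ?_ ?_
  · rw [closure_subtype]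
    have hd : Dense badᶜ := hbad.countable.dense_compl ℝ
    refine closure_mono ?_ (hd 0)
    exact fun e he => ⟨⟨e, Or.inr he⟩, he, rfl⟩
  · intro e he
    exact mem_RRat_of_polys (hgood e.1 he) (hF.loops_apply e)

lemma exists_polyPath_of_mem_RRat (hn : 1 ≤ n) {ℓ : OmegaRP m} (hℓ : ℓ ∈ RRat n m) :
    ∃ (c₀ : Fin n → ℝ) (c : Fin m → Fin n → ℝ), (∀ t, polyPath c₀ c t ≠ 0) ∧
      ∀ t, ℓ.1 (chart t) = proj (polyPath c₀ c t) := by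
  obtain ⟨p, hmon, hdeg, -, hx⟩ := hℓ
  have hq : ∀ i, Polynomial.X ^ n + Polynomial.ofFn n (Polynomial.toFn n (p i - Polynomial.X ^ n))
      = p i := by
    intro i
    rw [Polynomial.ofFn_comp_toFn_eq_id_of_natDegree_lt, add_sub_cancel]
    rcases eq_or_ne (p i - Polynomial.X ^ n) 0 with h0 | h0
    · rw [h0, Polynomial.natDegree_zero]
      exact hn
    refine (Polynomial.natDegree_lt_iff_degree_lt h0).2 ?_
    have hd : (p i).degree = n := by rw [Polynomial.degree_eq_natDegree (hmon i).ne_zero, hdeg i]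
    rw [← hd]
    refine Polynomial.degree_sub_lt_left (by rw [hd, Polynomial.degree_X_pow]) (hmon i).ne_zero ?_
    rw [(hmon i).leadingCoeff, (Polynomial.monic_X_pow n).leadingCoeff]
  let d : Fin (m + 1) → Fin n → ℝ := fun i => Polynomial.toFn n (p i - Polynomial.X ^ n)
  have hpolys : polys (d 0) (fun i => d i.succ - d 0) = p := by
    ext1 i
    refine Fin.cases (hq 0) (fun i => ?_) i
    simp only [polys, Fin.cons_succ, add_sub_cancel]
    exact hq i.succ
  have hne : ∀ x : ℝ, (fun i => (polys (d 0) (fun i => d i.succ - d 0) i).eval x) ≠ 0 := by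
    rw [hpolys]
    exact fun x => (hx x).1
  refine ⟨d 0, fun i => d i.succ - d 0, polyPath_ne_zero hne, fun t => ?_⟩
  by_cases ht : denom t = 0
  · rw [polyPath_of_denom_eq_zero _ _ ht, proj_smul (pow_ne_zero _ (numer_ne_zero ht)), proj_one,
      chart, if_pos ht, ℓ.2]
  · obtain ⟨h, h'⟩ := hx (numer t / denom t)
    rw [chart_of_ne ht, h', polyPath_eq _ _ ht, proj_smul (pow_ne_zero _ ht), hpolys, proj_of_ne]

lemma lift_eq_of_polyPath {ℓ : OmegaRP m} {c₀ : Fin n → ℝ} {c : Fin m → Fin n → ℝ}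
    (h0 : ∀ t, polyPath c₀ c t ≠ 0) (hℓ : ∀ t, ℓ.1 (chart t) = proj (polyPath c₀ c t)) (t : I) :
    lift ℓ t = ‖polyPath c₀ c t‖⁻¹ • polyPath c₀ c t := by
  refine lift_eq ?_ h0 ?_ hℓ t
  · exact continuous_polyPath continuous_const continuous_const continuous_id
  · rw [polyPath_of_denom_eq_zero _ _ denom_zero]
    simp

lemma RRat_subset_signLoops (hn : 1 ≤ n) : RRat n m ⊆ signLoops n m := by
  intro ℓ hℓ
  obtain ⟨c₀, c, h0, h⟩ := exists_polyPath_of_mem_RRat hn hℓ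
  rw [signLoops, Set.mem_ofPred_eq, lift_eq_of_polyPath h0 h,
    polyPath_of_denom_eq_zero _ _ denom_one]
  simp [norm_smul]

lemma ratSet_subset_signLoops (hn : 1 ≤ n) : ratSet n m ⊆ signLoops n m :=
  closure_minimal (RRat_subset_signLoops hn) (isClopen_signLoops n).isClosed

lemma exists_polyPath_near (hn : 1 ≤ n) {ℓ : OmegaRP m} (hℓ : ℓ ∈ ratSet n m) {δ : ℝ}
    (hδ : 0 < δ) : ∃ (c₀ : Fin n → ℝ) (c : Fin m → Fin n → ℝ),
      ∀ t, ∃ r : ℝ, 0 < r ∧ ‖polyPath c₀ c t - r • lift ℓ t‖ < r * δ := by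
  have hnear : ∀ᶠ ℓ' in 𝓝 ℓ, ∀ t ∈ Set.univ, ‖lift ℓ' t - lift ℓ t‖ < δ := by
    refine isCompact_univ.eventually_forall_of_forall_eventually fun t _ => ?_
    have hc : Continuous fun p : OmegaRP m × I => ‖lift p.1 p.2 - lift ℓ p.2‖ :=
      (continuous_lift.sub (continuous_lift.comp (continuous_const.prodMk continuous_snd))).norm
    exact hc.continuousAt.eventually_lt continuousAt_const (by simpa using hδ)
  obtain ⟨ℓ', hℓ', hrat⟩ := (mem_closure_iff_frequently.1 hℓ).and_eventually hnear |>.exists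
  obtain ⟨c₀, c, h0, h⟩ := exists_polyPath_of_mem_RRat hn hℓ'
  refine ⟨c₀, c, fun t => ⟨‖polyPath c₀ c t‖, norm_pos_iff.2 (h0 t), ?_⟩⟩
  have hr := norm_pos_iff.2 (h0 t)
  have h1 : polyPath c₀ c t = ‖polyPath c₀ c t‖ • lift ℓ' t := by
    rw [lift_eq_of_polyPath h0 h, smul_inv_smul₀ hr.ne']
  have h2 : polyPath c₀ c t - ‖polyPath c₀ c t‖ • lift ℓ t =
      ‖polyPath c₀ c t‖ • (lift ℓ' t - lift ℓ t) := by rw [smul_sub, ← h1]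
  rw [h2, norm_smul, norm_norm]
  exact mul_lt_mul_of_pos_left (hrat t trivial) hr

end Rat

section Approximation

variable {n : ℕ} {T : Type*}

/-- Families of loops with values in `rat(n,m)` over a given set. -/
def RatOn [TopologicalSpace T] (n : ℕ) (B : Set T) (γ : C(T, OmegaRP m)) : Prop :=
  ∀ b ∈ B, γ b ∈ ratSet n m

/-- Families of paths which are polynomial over a given set. -/
def PolyOn (n : ℕ) (B : Set T) (F : T → I → Fin (m + 1) → ℝ) : Prop :=
  ∀ b ∈ B, ∃ (c₀ : Fin n → ℝ) (c : Fin m → Fin n → ℝ), F b = polyPath c₀ c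

lemma IsFamily.loops_mem_ratSet [TopologicalSpace T] (hn : 1 ≤ n) (hm : 1 ≤ m)
    {F : T → I → Fin (m + 1) → ℝ} (hF : IsFamily n F) {B : Set T} (hB : PolyOn n B F) :
    RatOn n B hF.loops := by
  intro b hb
  obtain ⟨c₀, c, h⟩ := hB b hb
  refine mem_ratSet_of_polyPath (c₀ := c₀) (c := c) hn hm ?_ ?_ <;> rw [← h]
  · exact hF.ne_zero b
  · exact hF.loops_apply b

lemma homotopicWith_of_isFamily [TopologicalSpace T] {γ₀ γ₁ : C(T, OmegaRP m)} {B : Set T}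
    {F : I × T → I → Fin (m + 1) → ℝ} (hF : IsFamily n F)
    (h₀ : ∀ s t, (γ₀ s).1 (chart t) = proj (F (0, s) t))
    (h₁ : ∀ s t, (γ₁ s).1 (chart t) = proj (F (1, s) t))
    (hB : RatOn n (Prod.snd ⁻¹' B) hF.loops) : γ₀.HomotopicWith γ₁ (RatOn n B) :=
  ⟨{ toFun := hF.loops
     continuous_toFun := hF.loops.continuous
     map_zero_left := fun s => omega_ext fun t => by rw [h₀]; exact hF.loops_apply (0, s) t
     map_one_left := fun s => omega_ext fun t => by rw [h₁]; exact hF.loops_apply (1, s) t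
     prop' := fun t b hb => hB (t, b) hb }⟩

/-- Polynomial paths are stable under convex combinations. -/
lemma convex_polyPath {c₀ c₀' : Fin n → ℝ} {c c' : Fin m → Fin n → ℝ} {a b : ℝ}
    (hab : a + b = 1) (t : I) :
    a • polyPath c₀ c t + b • polyPath c₀' c' t =
      polyPath (a • c₀ + b • c₀') (a • c + b • c') t := by
  rw [polyPath, polyPath, polyPath, ← smul_mkV, ← smul_mkV, ← mkV_add]
  congr 1
  · simp only [lead, homog_add, homog_smul]
    linear_combination numer t ^ n * hab
  · ext i
    simp only [Pi.add_apply, Pi.smul_apply, smul_eq_mul, homog_add, homog_smul]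
    ring

lemma homotopicWith_of_segment [TopologicalSpace T] (hn : 1 ≤ n) (hm : 1 ≤ m) {B : Set T}
    {F F' : T → I → Fin (m + 1) → ℝ} (hF : IsFamily n F) (hF' : IsFamily n F')
    (hB : PolyOn n B F) (hB' : PolyOn n B F')
    (h : ∀ s t, ∀ τ ∈ Set.Icc (0 : ℝ) 1, (1 - τ) • F s t + τ • F' s t ≠ 0) :
    hF.loops.HomotopicWith hF'.loops (RatOn n B) := by
  let G : I × T → I → Fin (m + 1) → ℝ :=
    fun p t => (1 - (p.1 : ℝ)) • F p.2 t + (p.1 : ℝ) • F' p.2 t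
  have hG : IsFamily n G := by
    refine ⟨?_, fun p t => h p.2 t p.1 p.1.2, fun p => ?_, fun p => ?_⟩
    · have h1 := hF.continuous.comp
        (f := fun p : (I × T) × I => (p.1.2, p.2)) (by fun_prop)
      have h2 := hF'.continuous.comp
        (f := fun p : (I × T) × I => (p.1.2, p.2)) (by fun_prop)
      have hτ : Continuous fun p : (I × T) × I => (p.1.1 : ℝ) := by fun_prop
      exact ((continuous_const.sub hτ).smul h1).add (hτ.smul h2)
    · simp only [G, hF.map_zero, hF'.map_zero]
      module
    · simp only [G, hF.map_one, hF'.map_one]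
      module
  refine homotopicWith_of_isFamily hG ?_ ?_ (hG.loops_mem_ratSet hn hm ?_)
  · intro s t
    rw [hF.loops_apply]
    simp [G]
  · intro s t
    rw [hF'.loops_apply]
    simp [G]
  · rintro ⟨τ, b⟩ hb
    obtain ⟨c₀, c, h₁⟩ := hB b hb
    obtain ⟨c₀', c', h₂⟩ := hB' b hb
    refine ⟨(1 - (τ : ℝ)) • c₀ + (τ : ℝ) • c₀', (1 - (τ : ℝ)) • c + (τ : ℝ) • c', funext fun t => ?_⟩
    rw [← convex_polyPath (by ring)]
    simp only [G, h₁, h₂]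

lemma norm_normalize_sub_le {V : Type*} [NormedAddCommGroup V] [NormedSpace ℝ V] {v f : V}
    {r δ : ℝ} (hf : ‖f‖ = 1) (hr : 0 < r) (hδ : δ ≤ 1 / 2) (h : ‖v - r • f‖ < r * δ) :
    v ≠ 0 ∧ ‖‖v‖⁻¹ • v - f‖ ≤ 4 * δ := by
  have h1 : ‖r • f‖ = r := by rw [norm_smul, hf, mul_one, Real.norm_of_nonneg hr.le]
  have h2 := abs_norm_sub_norm_le v (r • f)
  rw [h1, abs_le] at h2
  have hδ0 : 0 < δ := by
    by_contra! hδ0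
    have := norm_nonneg (v - r • f)
    nlinarith
  have hv : r / 2 ≤ ‖v‖ := by nlinarith
  have hv0 : 0 < ‖v‖ := by linarith
  refine ⟨norm_pos_iff.1 hv0, ?_⟩
  have h3 : ‖v‖⁻¹ • v - f = ‖v‖⁻¹ • ((v - r • f) + (r - ‖v‖) • f) := by
    rw [smul_add, smul_sub, smul_smul, smul_smul, mul_sub, inv_mul_cancel₀ hv0.ne']
    module
  rw [h3, norm_smul, norm_inv, norm_norm, inv_mul_le_iff₀ hv0]
  have h4 : ‖(r - ‖v‖) • f‖ ≤ r * δ := by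
    rw [norm_smul, hf, mul_one, Real.norm_eq_abs, abs_le]
    constructor <;> linarith
  refine (norm_add_le _ _).trans ?_
  nlinarith

lemma convex_near {V : Type*} [NormedAddCommGroup V] [NormedSpace ℝ V] (f : V) (δ : ℝ) :
    Convex ℝ {v : V | ∃ r : ℝ, 0 < r ∧ ‖v - r • f‖ < r * δ} := by
  rw [convex_iff_forall_pos]
  rintro v ⟨r, hr, hv⟩ w ⟨q, hq, hw⟩ a b ha hb -
  refine ⟨a * r + b * q, by positivity, ?_⟩
  have h1 : a • v + b • w - (a * r + b * q) • f = a • (v - r • f) + b • (w - q • f) := by module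
  rw [h1]
  refine (norm_add_le _ _).trans_lt ?_
  rw [norm_smul, norm_smul, Real.norm_of_nonneg ha.le, Real.norm_of_nonneg hb.le]
  nlinarith [mul_lt_mul_of_pos_left hv ha, mul_lt_mul_of_pos_left hw hb]

lemma exists_approximation [MetricSpace T] (hn : 1 ≤ n) {B : Set T} (hB : IsClosed B)
    {γ : C(T, OmegaRP m)} (hγ : ∀ s, γ s ∈ signLoops n m) (hγB : RatOn n B γ) :
    ∃ g : C(T × Set.Ioc (0 : ℝ) 1, C(I, Fin (m + 1) → ℝ)), ∀ p,
      (g p 0 = 1 ∧ g p 1 = (-1 : ℝ) ^ n • 1) ∧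
      (∀ x, ∃ r : ℝ, 0 < r ∧ ‖g p x - r • lift (γ p.1) x‖ < r * ((p.2 : ℝ) / 2)) ∧
      (p.1 ∈ B → ∃ (c₀ : Fin n → ℝ) (c : Fin m → Fin n → ℝ), ⇑(g p) = polyPath c₀ c) := by
  have hlift : Continuous fun p : T × I => lift (γ p.1) p.2 := (isFamily_lift hγ).continuous
  let A : T × Set.Ioc (0 : ℝ) 1 → Set C(I, Fin (m + 1) → ℝ) := fun p =>
    {g | (g 0 = 1 ∧ g 1 = (-1 : ℝ) ^ n • 1) ∧
      (∀ x, g x ∈ {v | ∃ r : ℝ, 0 < r ∧ ‖v - r • lift (γ p.1) x‖ < r * ((p.2 : ℝ) / 2)}) ∧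
      (p.1 ∈ B → ∃ (c₀ : Fin n → ℝ) (c : Fin m → Fin n → ℝ), ⇑g = polyPath c₀ c)}
  have hconv : ∀ p, Convex ℝ (A p) := by
    rintro p g ⟨⟨hg0, hg1⟩, hg, hgB⟩ g' ⟨⟨hg0', hg1'⟩, hg', hgB'⟩ a b ha hb hab
    refine ⟨⟨?_, ?_⟩, fun x => ?_, fun hpB => ?_⟩
    · simp only [ContinuousMap.add_apply, ContinuousMap.smul_apply, hg0, hg0']
      rw [← add_smul, hab, one_smul]
    · simp only [ContinuousMap.add_apply, ContinuousMap.smul_apply, hg1, hg1']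
      rw [← add_smul, hab, one_smul]
    · exact convex_near _ _ (hg x) (hg' x) ha hb hab
    · obtain ⟨c₀, c, h₁⟩ := hgB hpB
      obtain ⟨c₀', c', h₂⟩ := hgB' hpB
      refine ⟨a • c₀ + b • c₀', a • c + b • c', funext fun t => ?_⟩
      rw [← convex_polyPath hab, ← h₁, ← h₂]
      rfl
  have hopen : ∀ (p : T × Set.Ioc (0 : ℝ) 1) (g : C(I, Fin (m + 1) → ℝ)),
      (∀ x, ∃ r : ℝ, 0 < r ∧ ‖g x - r • lift (γ p.1) x‖ < r * ((p.2 : ℝ) / 2)) →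
      ∀ᶠ q in 𝓝 p, ∀ x ∈ Set.univ,
        ∃ r : ℝ, 0 < r ∧ ‖g x - r • lift (γ q.1) x‖ < r * ((q.2 : ℝ) / 2) := by
    intro p g hg
    refine isCompact_univ.eventually_forall_of_forall_eventually fun x _ => ?_
    obtain ⟨r, hr, h⟩ := hg x
    have h1 : Continuous fun z : (T × Set.Ioc (0 : ℝ) 1) × I =>
        ‖g z.2 - r • lift (γ z.1.1) z.2‖ := by
      have := hlift.comp (f := fun z : (T × Set.Ioc (0 : ℝ) 1) × I => (z.1.1, z.2)) (by fun_prop)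
      exact ((g.continuous.comp continuous_snd).sub (this.const_smul r)).norm
    have h2 : Continuous fun z : (T × Set.Ioc (0 : ℝ) 1) × I => r * ((z.1.2 : ℝ) / 2) := by
      fun_prop
    exact (h1.continuousAt.eventually_lt h2.continuousAt h).mono fun z hz => ⟨r, hr, hz⟩
  have hloc : ∀ p, ∃ c, ∀ᶠ q in 𝓝 p, c ∈ A q := by
    rintro ⟨s, δ⟩
    have hδ : 0 < (δ : ℝ) / 2 := half_pos δ.2.1
    by_cases hs : s ∈ B
    · obtain ⟨c₀, c, h⟩ := exists_polyPath_near hn (hγB s hs) hδ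
      let g : C(I, Fin (m + 1) → ℝ) :=
        ⟨polyPath c₀ c, continuous_polyPath continuous_const continuous_const continuous_id⟩
      refine ⟨g, (hopen (s, δ) g h).mono fun q hq => ⟨⟨?_, ?_⟩, fun x => hq x trivial,
        fun _ => ⟨c₀, c, rfl⟩⟩⟩
      · exact (polyPath_of_denom_eq_zero _ _ denom_zero).trans (by simp)
      · exact (polyPath_of_denom_eq_zero _ _ denom_one).trans (by simp)
    · let g : C(I, Fin (m + 1) → ℝ) :=
        ⟨lift (γ s), hlift.comp (f := fun x => (s, x)) (by fun_prop)⟩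
      have hout : ∀ᶠ q : T × Set.Ioc (0 : ℝ) 1 in 𝓝 (s, δ), q.1 ∉ B :=
        (hB.isOpen_compl.preimage continuous_fst).mem_nhds hs
      refine ⟨g, ((hopen (s, δ) g fun x => ⟨1, one_pos, ?_⟩).and hout).mono fun q hq =>
        ⟨⟨lift_zero _, hγ s⟩, fun x => hq.1 x trivial, fun h => absurd h hq.2⟩⟩
      simpa [g] using δ.2.1
  exact exists_continuous_forall_mem_convex_of_local_const hconv hloc

lemma exists_family_homotopicWith [MetricSpace T] (hn : 1 ≤ n) (hm : 1 ≤ m) {B : Set T}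
    (hB : IsClosed B) {γ : C(T, OmegaRP m)} (hγ : ∀ s, γ s ∈ signLoops n m) (hγB : RatOn n B γ) :
    ∃ (F : T → I → Fin (m + 1) → ℝ) (hF : IsFamily n F), PolyOn n B F ∧
      γ.HomotopicWith hF.loops (RatOn n B) := by
  have hlift : Continuous fun p : T × I => lift (γ p.1) p.2 := (isFamily_lift hγ).continuous
  obtain ⟨g, hg⟩ := exists_approximation hn hB hγ hγB
  have hnear : ∀ (p : T × Set.Ioc (0 : ℝ) 1) x,
      g p x ≠ 0 ∧ ‖‖g p x‖⁻¹ • g p x - lift (γ p.1) x‖ ≤ 2 * (p.2 : ℝ) := by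
    intro p x
    obtain ⟨r, hr, h⟩ := (hg p).2.1 x
    have := norm_normalize_sub_le (norm_lift _ _) hr (by linarith [p.2.2.2]) h
    exact ⟨this.1, by linarith [this.2]⟩
  have hpos : ∀ {τ : I}, τ ≠ 0 → (τ : ℝ) ∈ Set.Ioc (0 : ℝ) 1 := fun {τ} h =>
    ⟨lt_of_le_of_ne τ.2.1 fun h' => h (Subtype.ext h'.symm), τ.2.2⟩
  have hgc : Continuous fun p : (T × Set.Ioc (0 : ℝ) 1) × I => g p.1 p.2 := by fun_prop
  let F : I × T → I → Fin (m + 1) → ℝ := fun p x => open Classical in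
    if h : p.1 = 0 then lift (γ p.2) x
    else ‖g (p.2, ⟨p.1, hpos h⟩) x‖⁻¹ • g (p.2, ⟨p.1, hpos h⟩) x
  have hF0 : ∀ s x, F (0, s) x = lift (γ s) x := fun s x => dif_pos rfl
  have hF1 : ∀ p : I × T, ∀ h : p.1 ≠ 0, ∀ x,
    F p x = ‖g (p.2, ⟨p.1, hpos h⟩) x‖⁻¹ • g (p.2, ⟨p.1, hpos h⟩) x := fun p h x => dif_neg h
  have hfar : ∀ (p : I × T) x, ‖F p x - lift (γ p.2) x‖ ≤ 2 * (p.1 : ℝ) := by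
    intro p x
    by_cases h : p.1 = 0
    · have : F p x = lift (γ p.2) x := dif_pos h
      simp [this, h]
    · rw [hF1 p h]
      exact (hnear _ x).2
  have hlift' : Continuous fun z : (I × T) × I => lift (γ z.1.2) z.2 :=
    hlift.comp (f := fun z : (I × T) × I => (z.1.2, z.2)) (by fun_prop)
  have hF : IsFamily n F := by
    refine ⟨?_, fun p x => ?_, fun p => ?_, fun p => ?_⟩
    · rw [continuous_iff_continuousAt]
      rintro ⟨⟨τ, s⟩, x⟩
      by_cases hτ : τ = 0
      · subst hτ
        have h1 : Filter.Tendsto (fun z : (I × T) × I => F z.1 z.2 - lift (γ z.1.2) z.2)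
            (𝓝 ((0, s), x)) (𝓝 0) := by
          refine squeeze_zero_norm (fun z => hfar z.1 z.2) ?_
          have : Continuous fun z : (I × T) × I => 2 * (z.1.1 : ℝ) := by fun_prop
          simpa using this.tendsto ((0, s), x)
        have h2 := h1.add (hlift'.tendsto ((0, s), x))
        rw [zero_add] at h2
        rw [ContinuousAt, hF0]
        exact h2.congr fun z => sub_add_cancel _ _
      · have hU : IsOpen {z : (I × T) × I | z.1.1 ≠ 0} :=
          isOpen_ne.preimage (continuous_fst.comp continuous_fst)
        refine ContinuousOn.continuousAt (s := {z : (I × T) × I | z.1.1 ≠ 0}) ?_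
          (hU.mem_nhds hτ)
        rw [continuousOn_iff_continuous_domRestrict]
        have h1 : Continuous fun z : {z : (I × T) × I | z.1.1 ≠ 0} =>
            g (z.1.1.2, ⟨z.1.1.1, hpos z.2⟩) z.1.2 :=
          hgc.comp (f := fun z : {z : (I × T) × I | z.1.1 ≠ 0} =>
            (((z.1.1.2, ⟨z.1.1.1, hpos z.2⟩), z.1.2) : (T × Set.Ioc (0 : ℝ) 1) × I)) (by fun_prop)
        refine ((h1.norm.inv₀ fun z => norm_ne_zero_iff.2 (hnear _ _).1).smul h1).congr fun z => ?_
        exact (hF1 z.1.1 z.2 z.1.2).symm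
    · by_cases h : p.1 = 0
      · have : F p x = lift (γ p.2) x := dif_pos h
        rw [this]
        exact lift_ne_zero _ _
      · rw [hF1 p h]
        exact smul_ne_zero (inv_ne_zero (norm_ne_zero_iff.2 (hnear _ _).1)) (hnear _ _).1
    · by_cases h : p.1 = 0
      · exact (dif_pos h).trans (lift_zero _)
      · rw [hF1 p h, (hg _).1.1]
        simp
    · by_cases h : p.1 = 0
      · exact (dif_pos h).trans (hγ _)
      · rw [hF1 p h, (hg _).1.2]
        simp [norm_smul]
  let G : T → I → Fin (m + 1) → ℝ := fun s => g (s, ⟨1, one_pos, le_rfl⟩)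
  have hG : IsFamily n G :=
    ⟨hgc.comp (f := fun z : T × I =>
        (((z.1, ⟨1, one_pos, le_rfl⟩), z.2) : (T × Set.Ioc (0 : ℝ) 1) × I)) (by fun_prop),
      fun s x => (hnear _ x).1, fun s => (hg _).1.1, fun s => (hg _).1.2⟩
  refine ⟨G, hG, fun b hb => (hg _).2.2 hb, homotopicWith_of_isFamily hF ?_ ?_ ?_⟩
  · intro s t
    rw [hF0, proj_lift]
  · intro s t
    rw [hG.loops_apply, hF1 (1, s) one_ne_zero,
      proj_smul (inv_ne_zero (norm_ne_zero_iff.2 (hnear _ _).1))]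
    rfl
  · rintro ⟨τ, b⟩ hb
    by_cases h : τ = 0
    · subst h
      rw [hF.loops_eq (γ := γ.comp ⟨Prod.snd, continuous_snd⟩) fun t => ?_]
      · exact hγB b hb
      · exact ((hF0 b t).symm ▸ proj_lift (γ b) t).symm
    · obtain ⟨c₀, c, hc⟩ := (hg (b, ⟨τ, hpos h⟩)).2.2 hb
      refine mem_ratSet_of_polyPath (c₀ := c₀) (c := c) hn hm ?_ ?_ <;> rw [← hc]
      · exact fun t => (hnear _ t).1
      · intro t
        rw [hF.loops_apply, hF1 (τ, b) h,
          proj_smul (inv_ne_zero (norm_ne_zero_iff.2 (hnear _ _).1))]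

end Approximation

section Deformation

variable {n : ℕ} {T : Type*}

lemma exists_homog_interpolate (hn : 1 ≤ n) {Z : Finset I} (hZ : Z.card ≤ n)
    (hd : ∀ t ∈ Z, denom t ≠ 0) (v : I → ℝ) :
    ∃ c : Fin n → ℝ, ∀ t ∈ Z, denom t * homog c t = v t := by
  have hinj : Set.InjOn (fun t => numer t / denom t) (Z : Set I) := fun s hs t ht h =>
    ratio_injective (hd s hs) (hd t ht) h
  let P := Lagrange.interpolate Z (fun t => numer t / denom t) fun t => v t / denom t ^ n
  have hP : P.natDegree < n := by
    rcases eq_or_ne P 0 with h0 | h0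
    · rw [h0, Polynomial.natDegree_zero]
      exact hn
    · refine (Polynomial.natDegree_lt_iff_degree_lt h0).2 ?_
      exact (Lagrange.degree_interpolate_lt _ hinj).trans_le (by exact_mod_cast hZ)
  refine ⟨Polynomial.toFn n P, fun t ht => ?_⟩
  rw [denom_mul_homog _ (hd t ht), Polynomial.ofFn_comp_toFn_eq_id_of_natDegree_lt hP,
    Lagrange.eval_interpolate_at_node _ hinj ht, mul_div_cancel₀ _ (pow_ne_zero _ (hd t ht))]

lemma exists_finset_lead_zeros (c : Fin n → ℝ) :
    ∃ Z : Finset I, Z.card ≤ n ∧ ∀ t, lead c t = 0 ↔ t ∈ Z := by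
  let p : Polynomial ℝ := Polynomial.X ^ n + Polynomial.ofFn n c
  have hd : ∀ {t}, lead c t = 0 → denom t ≠ 0 := fun {t} h hd => by
    rw [lead_of_denom_eq_zero _ hd] at h
    exact pow_ne_zero _ (numer_ne_zero hd) h
  have hmaps : Set.MapsTo (fun t => numer t / denom t) {t | lead c t = 0} p.roots.toFinset := by
    intro t ht
    have h := lead_eq c (hd ht)
    rw [show lead c t = 0 from ht, eq_comm, mul_eq_zero] at h
    simp only [Finset.mem_coe, Multiset.mem_toFinset]
    rw [Polynomial.mem_roots (monic_X_pow_add_ofFn c).ne_zero]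
    exact h.resolve_left (pow_ne_zero _ (hd ht))
  have hinj : Set.InjOn (fun t => numer t / denom t) {t | lead c t = 0} :=
    fun s hs t ht h => ratio_injective (hd hs) (hd ht) h
  have hfin : {t | lead c t = 0}.Finite :=
    Set.Finite.of_injOn hmaps hinj (Finset.finite_toSet _)
  refine ⟨hfin.toFinset, ?_, fun t => by simp⟩
  calc hfin.toFinset.card ≤ p.roots.toFinset.card :=
        Finset.card_le_card_of_injOn _ (fun t ht => hmaps (by simpa using ht))
          (by simpa using hinj)
    _ ≤ p.natDegree := (Multiset.toFinset_card_le _).trans (Polynomial.card_roots' p)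
    _ = n := natDegree_X_pow_add_ofFn c

lemma denom_ne_zero_of_lead {c : Fin n → ℝ} {t : I} (h : lead c t = 0) : denom t ≠ 0 := fun hd => by
  rw [lead_of_denom_eq_zero _ hd] at h
  exact pow_ne_zero _ (numer_ne_zero hd) h

/-- The differences of the coordinates of a path with its first coordinate. -/
def diffs (v : Fin (m + 1) → ℝ) : Fin m → ℝ := fun i => v i.succ - v 0

@[simp] lemma diffs_mkV (a : ℝ) (b : Fin m → ℝ) : diffs (mkV a b) = b := by
  ext i
  simp [diffs]

@[fun_prop] lemma continuous_diffs : Continuous (diffs (m := m)) := by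
  unfold diffs
  fun_prop

lemma mkV_diffs (v : Fin (m + 1) → ℝ) : mkV (v 0) (diffs v) = v := (eq_mkV v).symm

lemma IsFamily.of_denom_eq_zero [TopologicalSpace T] {F : T → I → Fin (m + 1) → ℝ}
    (hF : IsFamily n F) {t : I} (ht : denom t = 0) (s : T) : F s t = numer t ^ n • 1 := by
  rcases denom_eq_zero_iff.1 ht with rfl | rfl
  · simp [hF.map_zero]
  · simp [hF.map_one]

lemma isFamily_mkV [TopologicalSpace T] {u : T → I → ℝ} {w : T → I → Fin m → ℝ}
    (hu : Continuous fun p : T × I => u p.1 p.2) (hw : Continuous fun p : T × I => w p.1 p.2)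
    (hne : ∀ s t, u s t = 0 → w s t ≠ 0) (hu' : ∀ s t, denom t = 0 → u s t = numer t ^ n)
    (hw' : ∀ s t, denom t = 0 → w s t = 0) : IsFamily n fun s t => mkV (u s t) (w s t) where
  continuous := continuous_mkV hu hw
  ne_zero s t h := hne s t (mkV_eq_zero_iff.1 h).1 (mkV_eq_zero_iff.1 h).2
  map_zero s := by rw [hu' s 0 denom_zero, hw' s 0 denom_zero, mkV_smul_one]; simp
  map_one s := by rw [hu' s 1 denom_one, hw' s 1 denom_one, mkV_smul_one]; simp

lemma IsFamily.diffs_of_denom_eq_zero [TopologicalSpace T] {F : T → I → Fin (m + 1) → ℝ}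
    (hF : IsFamily n F) {t : I} (ht : denom t = 0) (s : T) : diffs (F s t) = 0 := by
  rw [hF.of_denom_eq_zero ht, ← mkV_smul_one, diffs_mkV]

lemma IsFamily.continuous_diffs [TopologicalSpace T] {F : T → I → Fin (m + 1) → ℝ}
    (hF : IsFamily n F) : Continuous fun p : T × I => diffs (F p.1 p.2) :=
  RatLoop.continuous_diffs.comp hF.continuous

lemma IsFamily.continuous_fst [TopologicalSpace T] {F : T → I → Fin (m + 1) → ℝ}
    (hF : IsFamily n F) : Continuous fun p : T × I => F p.1 p.2 0 :=
  (continuous_apply 0).comp hF.continuous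

lemma segment_mkV (τ a a' : ℝ) (b b' : Fin m → ℝ) :
    (1 - τ) • mkV a b + τ • mkV a' b' =
      mkV ((1 - τ) * a + τ * a') ((1 - τ) • b + τ • b') := by
  rw [mkV_add, smul_mkV, smul_mkV]

lemma exists_lead_homotopicWith [MetricSpace T] (hn : 1 ≤ n) (hm : 1 ≤ m) {B : Set T}
    {F : T → I → Fin (m + 1) → ℝ} (hF : IsFamily n F) (hB : PolyOn n B F)
    (hfin : ∀ s ∉ B, ∃ Z : Finset I, Z.card ≤ n ∧
      ∀ t, diffs (F s t) = 0 → denom t ≠ 0 → t ∈ Z) :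
    ∃ (r : C(T, Fin n → ℝ)) (hF' : IsFamily n fun s t => mkV (lead (r s) t) (diffs (F s t))),
      PolyOn n B (fun s t => mkV (lead (r s) t) (diffs (F s t))) ∧
        hF.loops.HomotopicWith hF'.loops (RatOn n B) := by
  have hu0 : ∀ s t, diffs (F s t) = 0 → F s t 0 ≠ 0 := fun s t hd h0 => by
    refine hF.ne_zero s t ?_
    rw [← mkV_diffs (F s t), mkV_eq_zero_iff]
    exact ⟨h0, hd⟩
  have hend : ∀ c s t, denom t = 0 → 0 < lead (n := n) c t * F s t 0 := by
    intro c s t ht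
    rw [hF.of_denom_eq_zero ht, lead_of_denom_eq_zero _ ht]
    simpa using mul_self_pos.2 (pow_ne_zero n (numer_ne_zero ht))
  obtain ⟨r, hr⟩ : ∃ r : C(T, Fin n → ℝ), ∀ s,
      r s ∈ {c | ∀ t, diffs (F s t) = 0 → 0 < lead c t * F s t 0} := by
    refine exists_continuous_forall_mem_convex_of_local_const (fun s => ?_) fun s => ?_
    · intro c hc c' hc' a b ha hb hab t ht
      have h1 : lead (a • c + b • c') t = a * lead c t + b * lead c' t := by
        simp only [lead, homog_add, homog_smul]
        linear_combination -numer t ^ n * hab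
      rw [h1]
      have := convex_Ioi (𝕜 := ℝ) (0 : ℝ) (hc t ht) (hc' t ht) ha hb hab
      simp only [smul_eq_mul, Set.mem_Ioi] at this
      linarith
    · obtain ⟨c, hc⟩ : ∃ c : Fin n → ℝ, ∀ t, diffs (F s t) = 0 → 0 < lead c t * F s t 0 := by
        by_cases hs : s ∈ B
        · obtain ⟨c₀, c, h⟩ := hB s hs
          refine ⟨c₀, fun t ht => ?_⟩
          have h1 : lead c₀ t = F s t 0 := by rw [h]; rfl
          rw [h1]
          exact mul_self_pos.2 (hu0 s t ht)
        · obtain ⟨Z, hZ, hZ'⟩ := hfin s hs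
          obtain ⟨c, hc⟩ := exists_homog_interpolate hn
            (Z := Z.filter fun t => denom t ≠ 0) ((Finset.card_filter_le _ _).trans hZ)
            (fun t ht => (Finset.mem_filter.1 ht).2) (fun t => F s t 0 - numer t ^ n)
          refine ⟨c, fun t ht => ?_⟩
          by_cases hd : denom t = 0
          · exact hend c s t hd
          · rw [lead, hc t (Finset.mem_filter.2 ⟨hZ' t ht hd, hd⟩), add_sub_cancel]
            exact mul_self_pos.2 (hu0 s t ht)
      refine ⟨c, ?_⟩
      have key : ∀ᶠ s' in 𝓝 s, ∀ t ∈ Set.univ, diffs (F s' t) = 0 → 0 < lead c t * F s' t 0 := by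
        refine isCompact_univ.eventually_forall_of_forall_eventually fun t _ => ?_
        by_cases ht : diffs (F s t) = 0
        · have h1 : Continuous fun p : T × I => lead c p.2 * F p.1 p.2 0 :=
            (continuous_lead continuous_const continuous_snd).mul hF.continuous_fst
          exact (continuousAt_const.eventually_lt h1.continuousAt (hc t ht)).mono
            fun p hp _ => hp
        · exact (hF.continuous_diffs.continuousAt.eventually_ne ht).mono fun p hp h => absurd h hp
      exact key.mono fun s' h t => h t trivial
  have hF' : IsFamily n fun s t => mkV (lead (r s) t) (diffs (F s t)) := by
    refine isFamily_mkV (by fun_prop) hF.continuous_diffs ?_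
      (fun s t ht => lead_of_denom_eq_zero _ ht) (fun s t ht => hF.diffs_of_denom_eq_zero ht s)
    intro s t h0 hd
    have := hr s t hd
    simp [h0] at this
  have hB' : PolyOn n B (fun s t => mkV (lead (r s) t) (diffs (F s t))) := by
    intro b hb
    obtain ⟨c₀, c, h⟩ := hB b hb
    refine ⟨r b, c, funext fun t => ?_⟩
    simp only [h, polyPath, diffs_mkV]
  refine ⟨r, hF', hB', homotopicWith_of_segment hn hm hF hF' hB hB' fun s t τ hτ => ?_⟩
  rw [← mkV_diffs (F s t), diffs_mkV, segment_mkV, Ne, mkV_eq_zero_iff]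
  rintro ⟨h1, h2⟩
  have hd : diffs (F s t) = 0 := by
    rw [← h2]
    module
  have h3 := hr s t hd
  have h4 := mul_self_pos.2 (hu0 s t hd)
  have h5 := convex_Ioi (𝕜 := ℝ) (0 : ℝ) h4 h3 (sub_nonneg.2 hτ.2) hτ.1 (by ring)
  simp only [smul_eq_mul, Set.mem_Ioi] at h5 h1
  have h6 : ((1 - τ) * F s t 0 + τ * lead (r s) t) * F s t 0 = 0 := by rw [h1, zero_mul]
  linarith

lemma exists_poly_homotopicWith [MetricSpace T] (hn : 1 ≤ n) (hm : 1 ≤ m) {B : Set T}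
    {r : C(T, Fin n → ℝ)} {w : T → I → Fin m → ℝ}
    (hF : IsFamily n fun s t => mkV (lead (r s) t) (w s t))
    (hB : PolyOn n B fun s t => mkV (lead (r s) t) (w s t)) :
    ∃ (F' : T → I → Fin (m + 1) → ℝ) (hF' : IsFamily n F'), PolyOn n Set.univ F' ∧
      hF.loops.HomotopicWith hF'.loops (RatOn n B) := by
  have hw0 : ∀ s t, lead (r s) t = 0 → w s t ≠ 0 := fun s t h0 hd =>
    hF.ne_zero s t (mkV_eq_zero_iff.2 ⟨h0, hd⟩)
  have hwc : Continuous fun p : T × I => w p.1 p.2 := by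
    have := hF.continuous_diffs
    simpa only [diffs_mkV] using this
  obtain ⟨q, hq⟩ : ∃ q : C(T, Fin m → Fin n → ℝ), ∀ s, q s ∈ {c | ∀ t, lead (r s) t = 0 →
      0 < ∑ i, denom t * homog (c i) t * w s t i} := by
    refine exists_continuous_forall_mem_convex_of_local_const (fun s => ?_) fun s => ?_
    · intro c hc c' hc' a b ha hb hab t ht
      have := convex_Ioi (𝕜 := ℝ) (0 : ℝ) (hc t ht) (hc' t ht) ha hb hab
      simp only [smul_eq_mul, Set.mem_Ioi] at this
      refine this.trans_eq ?_
      rw [Finset.mul_sum, Finset.mul_sum, ← Finset.sum_add_distrib]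
      refine Finset.sum_congr rfl fun i _ => ?_
      simp only [Pi.add_apply, Pi.smul_apply, homog_add, homog_smul]
      ring
    · obtain ⟨Z, hZ, hZ'⟩ := exists_finset_lead_zeros (r s)
      choose c hc using fun i : Fin m => exists_homog_interpolate hn hZ
        (fun t ht => denom_ne_zero_of_lead ((hZ' t).2 ht)) (fun t => w s t i)
      refine ⟨c, ?_⟩
      have key : ∀ᶠ s' in 𝓝 s, ∀ t ∈ Set.univ, lead (r s') t = 0 →
          0 < ∑ i, denom t * homog (c i) t * w s' t i := by
        refine isCompact_univ.eventually_forall_of_forall_eventually fun t _ => ?_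
        by_cases ht : lead (r s) t = 0
        · have h1 : Continuous fun p : T × I =>
              ∑ i, denom p.2 * homog (c i) p.2 * w p.1 p.2 i := by fun_prop
          refine (continuousAt_const.eventually_lt h1.continuousAt ?_).mono fun p hp _ => hp
          obtain ⟨j, hj⟩ := Function.ne_iff.1 (hw0 s t ht)
          simp only [hc _ t ((hZ' t).1 ht)]
          exact Finset.sum_pos' (fun i _ => mul_self_nonneg _)
            ⟨j, Finset.mem_univ _, mul_self_pos.2 hj⟩
        · have h1 : Continuous fun p : T × I => lead (r p.1) p.2 := by fun_prop
          exact (h1.continuousAt.eventually_ne ht).mono fun p hp h => absurd h hp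
      exact key.mono fun s' h t => h t trivial
  have hF' : IsFamily n fun s => polyPath (r s) (q s) := by
    refine isFamily_polyPath r.continuous q.continuous fun s t h => ?_
    rw [polyPath, mkV_eq_zero_iff] at h
    have h1 := hq s t h.1
    have h2 : ∀ i, denom t * homog (q s i) t = 0 := fun i => congrFun h.2 i
    simp [h2] at h1
  have hB' : PolyOn n Set.univ fun s => polyPath (r s) (q s) := fun s _ => ⟨r s, q s, rfl⟩
  refine ⟨_, hF', hB', homotopicWith_of_segment hn hm hF hF' hB (fun b _ => hB' b trivial)
    fun s t τ hτ => ?_⟩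
  rw [polyPath, segment_mkV, Ne, mkV_eq_zero_iff]
  rintro ⟨h1, h2⟩
  have h0 : lead (r s) t = 0 := by rw [← h1]; ring
  obtain ⟨j, hj⟩ := Function.ne_iff.1 (hw0 s t h0)
  have h4 : 0 < ∑ i, w s t i * w s t i :=
    Finset.sum_pos' (fun i _ => mul_self_nonneg _) ⟨j, Finset.mem_univ _, mul_self_pos.2 hj⟩
  have h5 := convex_Ioi (𝕜 := ℝ) (0 : ℝ) h4 (hq s t h0) (sub_nonneg.2 hτ.2) hτ.1 (by ring)
  simp only [smul_eq_mul, Set.mem_Ioi] at h5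
  refine h5.ne' ?_
  rw [Finset.mul_sum, Finset.mul_sum, ← Finset.sum_add_distrib]
  refine Finset.sum_eq_zero fun i _ => ?_
  have h6 := congrFun h2 i
  simp only [Pi.add_apply, Pi.smul_apply, smul_eq_mul, Pi.zero_apply] at h6
  linear_combination w s t i * h6

end Deformation

section Polynomials

/-- Evaluation of the polynomial with given coefficients. -/
def polyEval {M : ℕ} (y : Fin M → ℝ) (x : ℝ) : ℝ := ∑ i, y i * x ^ (i : ℕ)

lemma polyEval_eq {M : ℕ} (y : Fin M → ℝ) (x : ℝ) :
    polyEval y x = (Polynomial.ofFn M y).eval x := by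
  simp [polyEval, Polynomial.ofFn_eq_sum_monomial, Polynomial.eval_finsetSum]

@[fun_prop] lemma continuous_polyEval {T : Type*} [TopologicalSpace T] {M : ℕ} {y : T → Fin M → ℝ}
    {x : T → ℝ} (hy : Continuous y) (hx : Continuous x) :
    Continuous fun s => polyEval (y s) (x s) := by
  unfold polyEval
  fun_prop

lemma polyEval_add {M : ℕ} (y y' : Fin M → ℝ) (x : ℝ) :
    polyEval (y + y') x = polyEval y x + polyEval y' x := by
  simp [polyEval, add_mul, Finset.sum_add_distrib]

lemma polyEval_smul {M : ℕ} (a : ℝ) (y : Fin M → ℝ) (x : ℝ) :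
    polyEval (a • y) x = a * polyEval y x := by
  simp [polyEval, Finset.mul_sum, mul_assoc]

lemma exists_polynomial_near {w : I → ℝ} (hw : Continuous w) (h0 : w 0 = 0) (h1 : w 1 = 0)
    {ε : ℝ} (hε : 0 < ε) : ∃ p : Polynomial ℝ, ∀ t : I, |denom t * p.eval (t : ℝ) - w t| < ε := by
  obtain ⟨q, hq⟩ := exists_polynomial_near_of_continuousOn 0 1
    (Set.IccExtend zero_le_one w) hw.Icc_extend'.continuousOn (ε / 2) (half_pos hε)
  have hq' : ∀ t : I, |q.eval (t : ℝ) - w t| < ε / 2 := fun t => by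
    have := hq t t.2
    rwa [Set.IccExtend_val] at this
  let b : Polynomial ℝ := q - (Polynomial.C (q.eval 0) * (1 - Polynomial.X) +
    Polynomial.C (q.eval 1) * Polynomial.X)
  obtain ⟨a, ha⟩ : Polynomial.X - Polynomial.C 0 ∣ b := by
    rw [Polynomial.dvd_iff_isRoot]
    simp [b]
  obtain ⟨p, hp⟩ : Polynomial.X - Polynomial.C 1 ∣ a := by
    rw [Polynomial.dvd_iff_isRoot]
    have h : b.eval 1 = 0 := by simp [b]
    rw [ha] at h
    simpa using h
  refine ⟨-p, fun t => ?_⟩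
  have hb : denom t * (-p).eval (t : ℝ) = b.eval (t : ℝ) := by
    rw [ha, hp]
    simp [denom]
    ring
  have hb' : b.eval (t : ℝ) = q.eval (t : ℝ) - (q.eval 0 * (1 - t) + q.eval 1 * t) := by
    simp [b]
  have e0 := hq' 0
  have e1 := hq' 1
  have et := hq' t
  rw [h0, sub_zero] at e0
  rw [h1, sub_zero] at e1
  have t0 := t.2.1
  have t1 := t.2.2
  simp only [Set.Icc.coe_zero, Set.Icc.coe_one] at e0 e1
  rw [abs_lt] at e0 e1 et
  rw [hb, hb', abs_lt]
  constructor <;> nlinarith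

lemma exists_homog_eq_eval {n : ℕ} (c : Fin n → ℝ) :
    ∃ p : Polynomial ℝ, ∀ t : I, p.eval (t : ℝ) = homog c t := by
  refine ⟨∑ i : Fin n, Polynomial.C (c i) * ((1 - 2 * Polynomial.X) ^ (i : ℕ) *
    (Polynomial.X * (1 - Polynomial.X)) ^ (n - 1 - i : ℕ)), fun t => ?_⟩
  simp [Polynomial.eval_finsetSum, homog, numer, denom]

section Smooth

variable {E : Type*} [NormedAddCommGroup E] [NormedSpace ℝ E]

/-- Families of polynomials with continuously differentiable coefficients. -/
def SmoothCoeff (p : E → Polynomial ℝ) : Prop := ∀ i, ContDiff ℝ 1 fun e => (p e).coeff i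

lemma SmoothCoeff.mul {p q : E → Polynomial ℝ} (hp : SmoothCoeff p) (hq : SmoothCoeff q) :
    SmoothCoeff fun e => p e * q e := by
  intro i
  simp only [Polynomial.coeff_mul]
  exact ContDiff.sum fun a _ => (hp a.1).mul (hq a.2)

lemma smoothCoeff_const (p : Polynomial ℝ) : SmoothCoeff fun _ : E => p := fun _ => contDiff_const

lemma SmoothCoeff.prod {ι : Type*} (s : Finset ι) {p : ι → E → Polynomial ℝ}
    (hp : ∀ i, SmoothCoeff (p i)) : SmoothCoeff fun e => ∏ i ∈ s, p i e := by
  classical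
  induction s using Finset.induction_on with
  | empty => simpa using smoothCoeff_const 1
  | insert i s hi ih =>
    simp only [Finset.prod_insert hi]
    exact (hp i).mul ih

lemma smoothCoeff_X_sub_C {f : E → ℝ} (hf : ContDiff ℝ 1 f) :
    SmoothCoeff fun e => Polynomial.X - Polynomial.C (f e) := by
  intro i
  simp only [Polynomial.coeff_sub, Polynomial.coeff_C]
  by_cases h : i = 0
  · simpa [h] using hf.neg
  · simpa [h] using contDiff_const

lemma smoothCoeff_ofFn {M : ℕ} {f : E → Fin M → ℝ} (hf : ContDiff ℝ 1 f) :
    SmoothCoeff fun e => Polynomial.ofFn M (f e) := by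
  intro i
  by_cases h : i < M
  · simp only [Polynomial.ofFn_coeff_eq_val_of_lt _ h]
    exact contDiff_pi.1 hf ⟨i, h⟩
  · simp only [Polynomial.ofFn_coeff_eq_zero_of_ge _ (not_lt.1 h)]
    exact contDiff_const

end Smooth

/-- If `k` is small, a smooth `k`-parameter family of `m`-tuples of polynomials can be moved
slightly so that no member has many common zeros. -/
lemma dense_few_zeros {k L N : ℕ} (hk : k + L < m * L) {U : Set (Fin k → ℝ)} (hU : Convex ℝ U)
    {χ : (Fin k → ℝ) → ℝ} (hχ : ContDiff ℝ 1 χ) (hχU : ∀ s ∈ U, χ s ≠ 0)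
    {y : (Fin k → ℝ) → Fin m → Fin (L + N) → ℝ} (hy : ContDiff ℝ 1 y) :
    Dense {z : Fin m → Fin (L + N) → ℝ | ∀ s ∈ U, ∀ x : Fin L → ℝ, Function.Injective x →
      ∃ i j, polyEval (y s i + χ s • z i) (x j) ≠ 0} := by
  let D : (Fin L → ℝ) × (Fin m → Fin N → ℝ) → Fin m → Fin (L + N) → ℝ := fun e i =>
    Polynomial.toFn (L + N)
      ((∏ j, (Polynomial.X - Polynomial.C (e.1 j))) * Polynomial.ofFn N (e.2 i))
  have hD : ContDiff ℝ 1 D := by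
    rw [contDiff_pi]
    intro i
    rw [contDiff_pi]
    intro l
    have h1 : SmoothCoeff fun e : (Fin L → ℝ) × (Fin m → Fin N → ℝ) =>
        ∏ j, (Polynomial.X - Polynomial.C (e.1 j)) :=
      SmoothCoeff.prod _ fun j => smoothCoeff_X_sub_C (by fun_prop)
    have h2 : SmoothCoeff fun e : (Fin L → ℝ) × (Fin m → Fin N → ℝ) =>
        Polynomial.ofFn N (e.2 i) := smoothCoeff_ofFn (by fun_prop)
    exact h1.mul h2 l
  let Ψ : (Fin k → ℝ) × (Fin L → ℝ) × (Fin m → Fin N → ℝ) → Fin m → Fin (L + N) → ℝ :=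
    fun e => (χ e.1)⁻¹ • (D e.2 - y e.1)
  have hΨ : ContDiffOn ℝ 1 Ψ (U ×ˢ Set.univ) := by
    refine ContDiffOn.smul (ContDiffOn.inv ?_ fun e he => hχU _ he.1) ?_
    · exact (hχ.comp contDiff_fst).contDiffOn
    · exact ((hD.comp contDiff_snd).sub (hy.comp contDiff_fst)).contDiffOn
  have hdim : dimH (U ×ˢ (Set.univ : Set ((Fin L → ℝ) × (Fin m → Fin N → ℝ)))) <
      Module.finrank ℝ (Fin m → Fin (L + N) → ℝ) := by
    refine (dimH_mono (Set.subset_univ _)).trans_lt ?_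
    have h1 : Module.finrank ℝ ((Fin k → ℝ) × (Fin L → ℝ) × (Fin m → Fin N → ℝ)) =
        k + (L + m * N) := by simp [Module.finrank_pi_fintype]
    have h2 : Module.finrank ℝ (Fin m → Fin (L + N) → ℝ) = m * (L + N) := by
      simp [Module.finrank_pi_fintype]
    rw [Real.dimH_univ_eq_finrank, h1, h2]
    have : k + (L + m * N) < m * (L + N) := by linarith [mul_add m L N]
    exact_mod_cast this
  have key := hΨ.dense_compl_image_of_dimH_lt_finrank (hU.prod convex_univ) subset_rfl hdim
  refine key.mono fun z hz s hs x hx => ?_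
  by_contra! hzero
  have hdvd : ∀ i, ∃ c : Fin N → ℝ, Polynomial.ofFn (L + N) (y s i + χ s • z i) =
      (∏ j, (Polynomial.X - Polynomial.C (x j))) * Polynomial.ofFn N c := by
    intro i
    set p := Polynomial.ofFn (L + N) (y s i + χ s • z i) with hp
    obtain ⟨q, hq⟩ : (∏ j, (Polynomial.X - Polynomial.C (x j))) ∣ p := by
      refine Fintype.prod_dvd_of_coprime (Polynomial.pairwise_coprime_X_sub_C hx) fun j => ?_
      rw [Polynomial.dvd_iff_isRoot, Polynomial.IsRoot, hp, ← polyEval_eq]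
      exact hzero i j
    have hmon : (∏ j, (Polynomial.X - Polynomial.C (x j))).Monic :=
      Polynomial.monic_prod_X_sub_C x Finset.univ
    rcases eq_or_ne q 0 with rfl | hq0
    · exact ⟨0, by rw [hq, map_zero]⟩
    have hdeg : q.natDegree < N := by
      have h1 : p.natDegree < L + N := by
        refine (Polynomial.natDegree_lt_iff_degree_lt ?_).2 (Polynomial.ofFn_degree_lt _)
        rw [hq]
        exact mul_ne_zero hmon.ne_zero hq0
      rw [hq, hmon.natDegree_mul' hq0, Polynomial.natDegree_finsetProd_X_sub_C_eq_card] at h1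
      simp at h1
      omega
    exact ⟨Polynomial.toFn N q, by rw [hq, Polynomial.ofFn_comp_toFn_eq_id_of_natDegree_lt hdeg]⟩
  choose c hc using hdvd
  refine hz ⟨(s, x, c), ⟨hs, trivial⟩, ?_⟩
  have h1 : D (x, c) = y s + χ s • z := by
    ext1 i
    simp only [D]
    rw [← hc, Polynomial.toFn_comp_ofFn_eq_id]
    rfl
  simp only [Ψ]
  rw [h1, add_sub_cancel_left, inv_smul_smul₀ (hχU s hs)]

end Polynomials

section Generic

variable {n : ℕ} {T : Type*} [TopologicalSpace T]

/-- Polynomials approximating a family of vectors of functions, exact on a given set. -/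
def Approximates (n : ℕ) (B : Set T) (w : T → I → Fin m → ℝ) (ε : ℝ) (s : T)
    (p : Fin m → ℝ → ℝ) : Prop :=
  (∀ t, ‖(fun i => denom t * p i t) - w s t‖ < ε) ∧
    (s ∈ B → ∃ c : Fin m → Fin n → ℝ, ∀ i (t : I), p i t = homog (c i) t)

lemma exists_local_approximation {B : Set T} (hBc : IsClosed B) {w : T → I → Fin m → ℝ}
    (hw : Continuous fun p : T × I => w p.1 p.2) (hw0 : ∀ s t, denom t = 0 → w s t = 0)
    (hB : ∀ s ∈ B, ∃ c : Fin m → Fin n → ℝ, ∀ t i, w s t i = denom t * homog (c i) t)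
    {ε : ℝ} (hε : 0 < ε) (s : T) :
    ∃ p : Fin m → Polynomial ℝ, ∀ᶠ s' in 𝓝 s, Approximates n B w ε s' fun i x => (p i).eval x := by
  have hopen : ∀ p : Fin m → Polynomial ℝ,
      (∀ t : I, ‖(fun i => denom t * (p i).eval (t : ℝ)) - w s t‖ < ε) → ∀ᶠ s' in 𝓝 s,
        ∀ t ∈ (Set.univ : Set I), ‖(fun i => denom t * (p i).eval (t : ℝ)) - w s' t‖ < ε := by
    intro p hp
    refine isCompact_univ.eventually_forall_of_forall_eventually fun t _ => ?_
    have h1 : Continuous fun q : T × I =>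
        ‖(fun i => denom q.2 * (p i).eval (q.2 : ℝ)) - w q.1 q.2‖ := by
      have : Continuous fun q : T × I => fun i => denom q.2 * (p i).eval (q.2 : ℝ) := by fun_prop
      exact (this.sub hw).norm
    exact h1.continuousAt.eventually_lt continuousAt_const (hp t)
  by_cases hs : s ∈ B
  · obtain ⟨c, hc⟩ := hB s hs
    choose p hp using fun i => exists_homog_eq_eval (c i)
    refine ⟨p, (hopen p fun t => ?_).mono fun s' h => ⟨fun t => h t trivial, fun _ => ⟨c, hp⟩⟩⟩
    have : (fun i => denom t * (p i).eval (t : ℝ)) - w s t = 0 := by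
      ext i
      simp [hp, hc]
    rwa [this, norm_zero]
  · have hws : Continuous fun t => w s t := hw.comp (f := fun t => (s, t)) (by fun_prop)
    choose p hp using fun i => exists_polynomial_near (w := fun t => w s t i)
      (by fun_prop) (by simp [hw0]) (by simp [hw0]) hε
    refine ⟨p, ((hopen p fun t => ?_).and (hBc.isOpen_compl.mem_nhds hs)).mono
      fun s' h => ⟨fun t => h.1 t trivial, fun h' => absurd h' h.2⟩⟩
    exact (pi_norm_lt_iff hε).2 fun i => hp i t

lemma exists_approximation_degree [CompactSpace T] {B : Set T} (hBc : IsClosed B)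
    {w : T → I → Fin m → ℝ} (hw : Continuous fun p : T × I => w p.1 p.2)
    (hw0 : ∀ s t, denom t = 0 → w s t = 0)
    (hB : ∀ s ∈ B, ∃ c : Fin m → Fin n → ℝ, ∀ t i, w s t i = denom t * homog (c i) t)
    {ε : ℝ} (hε : 0 < ε) :
    ∃ M₀, ∀ M ≥ M₀, ∀ s, ∃ y : Fin m → Fin M → ℝ,
      ∀ᶠ s' in 𝓝 s, Approximates n B w ε s' fun i => polyEval (y i) := by
  have key : ∃ M₀, ∀ M ≥ M₀, ∀ s ∈ Set.univ, ∃ y : Fin m → Fin M → ℝ,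
      ∀ᶠ s' in 𝓝 s, Approximates n B w ε s' fun i => polyEval (y i) := by
    refine isCompact_univ.induction_on
      (p := fun S => ∃ M₀, ∀ M ≥ M₀, ∀ s ∈ S, ∃ y : Fin m → Fin M → ℝ,
        ∀ᶠ s' in 𝓝 s, Approximates n B w ε s' fun i => polyEval (y i)) ?_ ?_ ?_ ?_
    · exact ⟨0, fun _ _ s hs => hs.elim⟩
    · rintro S S' hS ⟨M₀, h⟩
      exact ⟨M₀, fun M hM s hs => h M hM s (hS hs)⟩
    · rintro S S' ⟨M₀, h⟩ ⟨M₀', h'⟩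
      refine ⟨max M₀ M₀', fun M hM s hs => ?_⟩
      rcases hs with hs | hs
      · exact h M ((le_max_left _ _).trans hM) s hs
      · exact h' M ((le_max_right _ _).trans hM) s hs
    · intro s _
      obtain ⟨p, hp⟩ := exists_local_approximation hBc hw hw0 hB hε s
      refine ⟨_, mem_nhdsWithin_of_mem_nhds (eventually_eventually_nhds.2 hp),
        Finset.univ.sup (fun i => (p i).natDegree) + 1, fun M hM s' hs' =>
        ⟨fun i => Polynomial.toFn M (p i), ?_⟩⟩
      have h1 : (fun i => polyEval (Polynomial.toFn M (p i))) = fun i x => (p i).eval x := by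
        ext i x
        rw [polyEval_eq, Polynomial.ofFn_comp_toFn_eq_id_of_natDegree_lt]
        exact (Nat.lt_succ_of_le
          (Finset.le_sup (f := fun i => (p i).natDegree) (Finset.mem_univ i))).trans_le hM
      rw [h1]
      exact hs'
  exact key.imp fun M₀ h M hM s => h M hM s trivial

/-- A function on Euclidean space vanishing in the unit cube exactly on its boundary. -/
def bump {k : ℕ} (x : Fin k → ℝ) : ℝ := ∏ i, (x i * (1 - x i))

lemma contDiff_bump {k : ℕ} : ContDiff ℝ 1 (bump (k := k)) :=
  contDiff_prod fun i _ => by fun_prop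

lemma bump_eq_zero_iff {k : ℕ} {s : Fin k → I} :
    bump (fun i => (s i : ℝ)) = 0 ↔ s ∈ Cube.boundary (Fin k) := by
  rw [bump, Finset.prod_eq_zero_iff]
  simp only [Finset.mem_univ, true_and]
  exact exists_congr fun i => denom_eq_zero_iff

lemma isClosed_boundary (k : ℕ) : IsClosed (Cube.boundary (Fin k)) := by
  have : Cube.boundary (Fin k) = {s | bump (fun i => (s i : ℝ)) = 0} := by
    ext s
    exact bump_eq_zero_iff.symm
  rw [this]
  exact isClosed_eq (contDiff_bump.continuous.comp
    (continuous_pi fun i => continuous_subtype_val.comp (continuous_apply i))) continuous_const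

open scoped Manifold ContDiff in
lemma exists_smooth_approximation {k : ℕ} {w : (Fin k → I) → I → Fin m → ℝ}
    (hw : Continuous fun p : (Fin k → I) × I => w p.1 p.2) (hw0 : ∀ s t, denom t = 0 → w s t = 0)
    (hB : ∀ s ∈ Cube.boundary (Fin k),
      ∃ c : Fin m → Fin n → ℝ, ∀ t i, w s t i = denom t * homog (c i) t)
    {ε : ℝ} (hε : 0 < ε) (L : ℕ) :
    ∃ (N : ℕ) (y : (Fin k → ℝ) → Fin m → Fin (L + N) → ℝ), ContDiff ℝ 1 y ∧
      ∀ s : Fin k → I, Approximates n (Cube.boundary (Fin k)) w ε s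
        fun i => polyEval (y (fun j => s j) i) := by
  obtain ⟨N, hN⟩ := exists_approximation_degree (isClosed_boundary k) hw hw0 hB hε
  let π : (Fin k → ℝ) → Fin k → I := fun x i => Set.projIcc 0 1 zero_le_one (x i)
  have hπ : Continuous π := continuous_pi fun i => continuous_projIcc.comp (continuous_apply i)
  suffices ∃ y : C^1⟮modelWithCornersSelf ℝ (Fin k → ℝ), Fin k → ℝ;
      modelWithCornersSelf ℝ (Fin m → Fin (L + N) → ℝ), Fin m → Fin (L + N) → ℝ⟯, ∀ x,
      y x ∈ {y | Approximates n (Cube.boundary (Fin k)) w ε (π x) fun i => polyEval (y i)} by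
    obtain ⟨y, hy⟩ := this
    refine ⟨N, y, y.contMDiff.contDiff, fun s => ?_⟩
    have : π (fun j => s j) = s := funext fun j => Set.projIcc_val _ _
    have h := hy fun j => s j
    simp only [this] at h
    exact h
  refine exists_contMDiffMap_forall_mem_convex_of_local_const _ (fun x => ?_) (fun x => ?_)
  · rintro y ⟨hy, hyB⟩ y' ⟨hy', hyB'⟩ a b ha hb hab
    refine ⟨fun t => ?_, fun hx => ?_⟩
    · have h1 := convex_ball (0 : Fin m → ℝ) ε (mem_ball_zero_iff.2 (hy t))
        (mem_ball_zero_iff.2 (hy' t)) ha hb hab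
      rw [mem_ball_zero_iff] at h1
      refine lt_of_eq_of_lt (congrArg _ (funext fun i => ?_)) h1
      simp only [Pi.add_apply, Pi.smul_apply, Pi.sub_apply, smul_eq_mul, polyEval_add,
        polyEval_smul]
      linear_combination w (π x) t i * hab
    · obtain ⟨c, hc⟩ := hyB hx
      obtain ⟨c', hc'⟩ := hyB' hx
      refine ⟨a • c + b • c', fun i t => ?_⟩
      simp only [Pi.add_apply, Pi.smul_apply, polyEval_add, polyEval_smul, hc, hc', homog_add,
        homog_smul]
  · obtain ⟨y, hy⟩ := hN (L + N) (Nat.le_add_left _ _) (π x)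
    exact ⟨y, hπ.continuousAt.eventually hy⟩

end Generic

lemma exists_finset_of_not_injective {X : Type*} {S : Set X} {n : ℕ}
    (h : ∀ x : Fin (n + 1) → X, Function.Injective x → ∃ j, x j ∉ S) :
    ∃ Z : Finset X, Z.card ≤ n ∧ ∀ t ∈ S, t ∈ Z := by
  by_cases hS : S.encard ≤ n
  · have hfin : S.Finite := Set.finite_of_encard_le_coe hS
    refine ⟨hfin.toFinset, ?_, fun t ht => hfin.mem_toFinset.2 ht⟩
    rwa [hfin.encard_eq_coe_toFinset_card, Nat.cast_le] at hS
  · have h1 : ((n + 1 : ℕ) : ℕ∞) ≤ S.encard := by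
      rw [Nat.cast_succ]
      exact Order.add_one_le_of_lt (not_le.1 hS)
    obtain ⟨Z, hZS, hZ⟩ := Set.exists_subset_encard_eq h1
    have hfin : Z.Finite := Set.finite_of_encard_eq_coe hZ
    have hcard : hfin.toFinset.card = n + 1 := by
      rw [hfin.encard_eq_coe_toFinset_card] at hZ
      exact_mod_cast hZ
    let e := (hfin.toFinset.equivFinOfCardEq hcard).symm
    obtain ⟨j, hj⟩ := h (fun j => (e j : X)) (Subtype.val_injective.comp e.injective)
    exact absurd (hZS (hfin.mem_toFinset.1 (e j).2)) hj

lemma exists_few_zeros_homotopicWith {n k : ℕ} (hn : 1 ≤ n) (hm : 2 ≤ m) (hk : k ≤ n * (m - 1))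
    {F : (Fin k → I) → I → Fin (m + 1) → ℝ} (hF : IsFamily n F)
    (hB : PolyOn n (Cube.boundary (Fin k)) F) :
    ∃ (F' : (Fin k → I) → I → Fin (m + 1) → ℝ) (hF' : IsFamily n F'),
      PolyOn n (Cube.boundary (Fin k)) F' ∧
      hF.loops.HomotopicWith hF'.loops (RatOn n (Cube.boundary (Fin k))) ∧
      ∀ s ∉ Cube.boundary (Fin k), ∃ Z : Finset I, Z.card ≤ n ∧
        ∀ t, diffs (F' s t) = 0 → denom t ≠ 0 → t ∈ Z := by
  obtain ⟨ρ, hρ, hρF⟩ : ∃ ρ > 0, ∀ s t, F s t 0 = 0 → ρ ≤ ‖diffs (F s t)‖ := by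
    have hc : Continuous fun p : (Fin k → I) × I => max |F p.1 p.2 0| ‖diffs (F p.1 p.2)‖ :=
      hF.continuous_fst.abs.max hF.continuous_diffs.norm
    obtain ⟨p, -, hp⟩ := isCompact_univ.exists_isMinOn Set.univ_nonempty hc.continuousOn
    refine ⟨_, ?_, fun s t h0 => (hp (Set.mem_univ (s, t))).trans_eq ?_⟩
    · by_contra! hle
      obtain ⟨h1, h2⟩ := max_le_iff.1 hle
      refine hF.ne_zero p.1 p.2 ?_
      rw [← mkV_diffs (F p.1 p.2), mkV_eq_zero_iff]
      exact ⟨abs_nonpos_iff.1 h1, norm_le_zero_iff.1 h2⟩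
    · simp [h0]
  have hBw : ∀ s ∈ Cube.boundary (Fin k),
      ∃ c : Fin m → Fin n → ℝ, ∀ t i, diffs (F s t) i = denom t * homog (c i) t := by
    intro s hs
    obtain ⟨c₀, c, h⟩ := hB s hs
    exact ⟨c, fun t i => by rw [h, polyPath, diffs_mkV]⟩
  obtain ⟨N, y, hy, hyF⟩ := exists_smooth_approximation hF.continuous_diffs
    (fun s t ht => hF.diffs_of_denom_eq_zero ht s) hBw (half_pos hρ) (n + 1)
  have hdim : k + (n + 1) < m * (n + 1) := by
    obtain ⟨l, rfl⟩ := Nat.exists_eq_add_of_le' hm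
    rw [show l + 2 - 1 = l + 1 from rfl] at hk
    nlinarith
  have hdense := dense_few_zeros hdim (U := {x : Fin k → ℝ | ∀ i, x i ∈ Set.Ioo (0 : ℝ) 1})
    (fun x hx x' hx' a b ha hb hab i => convex_Ioo (0 : ℝ) 1 (hx i) (hx' i) ha hb hab)
    contDiff_bump (fun s hs => Finset.prod_ne_zero_iff.2 fun i _ =>
      mul_ne_zero (hs i).1.ne' (sub_pos.2 (hs i).2).ne') hy
  have hsmall : ∀ᶠ z : Fin m → Fin (n + 1 + N) → ℝ in 𝓝 0,
      ∀ p ∈ (Set.univ : Set ((Fin k → I) × I)),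
        ‖fun i => denom p.2 * (bump (fun j => (p.1 j : ℝ)) * polyEval (z i) p.2)‖ < ρ / 2 := by
    refine isCompact_univ.eventually_forall_of_forall_eventually fun p _ => ?_
    have h1 : Continuous fun q : (Fin m → Fin (n + 1 + N) → ℝ) × ((Fin k → I) × I) =>
        ‖fun i => denom q.2.2 * (bump (fun j => (q.2.1 j : ℝ)) * polyEval (q.1 i) q.2.2)‖ := by
      refine (continuous_pi fun i => ?_).norm
      have h2 : Continuous fun q : (Fin m → Fin (n + 1 + N) → ℝ) × ((Fin k → I) × I) =>
          bump (fun j => (q.2.1 j : ℝ)) :=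
        contDiff_bump.continuous.comp (g := bump) (by fun_prop)
      have h3 : Continuous fun q : (Fin m → Fin (n + 1 + N) → ℝ) × ((Fin k → I) × I) =>
          polyEval (q.1 i) q.2.2 := by
        unfold polyEval
        fun_prop
      fun_prop
    refine h1.continuousAt.eventually_lt continuousAt_const ?_
    simpa [polyEval, ← Pi.zero_def] using hρ
  obtain ⟨z, hz, hz'⟩ := hdense.inter_nhds_nonempty hsmall
  let v : (Fin k → I) → Fin m → Fin (n + 1 + N) → ℝ := fun s i =>
    y (fun j => s j) i + bump (fun j => (s j : ℝ)) • z i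
  have hv : Continuous v := by
    have h2 : Continuous fun s : Fin k → I => bump (fun j => (s j : ℝ)) :=
      contDiff_bump.continuous.comp (g := bump) (by fun_prop)
    have h3 : Continuous fun s : Fin k → I => y (fun j => (s j : ℝ)) :=
      hy.continuous.comp (g := y) (by fun_prop)
    fun_prop
  have hclose : ∀ s t, ‖(fun i => denom t * polyEval (v s i) t) - diffs (F s t)‖ < ρ := by
    intro s t
    have h1 := (norm_add_le _ _).trans_lt (add_lt_add ((hyF s).1 t) (hz' (s, t) trivial))
    rw [add_halves] at h1
    refine lt_of_eq_of_lt (congrArg _ (funext fun i => ?_)) h1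
    simp only [v, Pi.add_apply, Pi.sub_apply, polyEval_add, polyEval_smul]
    ring
  have hseg : ∀ s t, ∀ τ ∈ Set.Icc (0 : ℝ) 1, F s t 0 = 0 →
      (1 - τ) • diffs (F s t) + τ • (fun i => denom t * polyEval (v s i) t) ≠ 0 := by
    intro s t τ hτ h0 h
    have h1 : diffs (F s t) =
        -(τ • ((fun i => denom t * polyEval (v s i) t) - diffs (F s t))) := by
      rw [eq_neg_iff_add_eq_zero, ← h]
      module
    have h2 := hρF s t h0
    rw [h1, norm_neg, norm_smul, Real.norm_of_nonneg hτ.1] at h2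
    have h3 := hclose s t
    nlinarith [mul_le_mul_of_nonneg_right hτ.2
      (norm_nonneg ((fun i => denom t * polyEval (v s i) t) - diffs (F s t)))]
  have hF' : IsFamily n fun s t => mkV (F s t 0) fun i => denom t * polyEval (v s i) t := by
    refine isFamily_mkV hF.continuous_fst ?_ (fun s t h0 h => ?_) (fun s t ht => ?_)
      (fun s t ht => ?_)
    · unfold polyEval
      fun_prop
    · refine hseg s t 1 ⟨zero_le_one, le_rfl⟩ h0 ?_
      rw [h]
      simp
    · rw [hF.of_denom_eq_zero ht]
      simp
    · ext i
      simp [ht]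
  have hB' : PolyOn n (Cube.boundary (Fin k))
      fun s t => mkV (F s t 0) fun i => denom t * polyEval (v s i) t := by
    intro s hs
    obtain ⟨c₀, c, h⟩ := hB s hs
    obtain ⟨c', hc'⟩ := (hyF s).2 hs
    refine ⟨c₀, c', funext fun t => ?_⟩
    have h1 : bump (fun j => (s j : ℝ)) = 0 := bump_eq_zero_iff.2 hs
    have h2 : F s t 0 = lead c₀ t := by rw [h]; rfl
    simp only [polyPath, v, h1, h2, zero_smul, add_zero, hc']
  refine ⟨_, hF', hB', homotopicWith_of_segment hn (one_le_two.trans hm) hF hF' hB hB'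
    fun s t τ hτ => ?_, fun s hs => ?_⟩
  · rw [show (1 - τ) • F s t = (1 - τ) • mkV (F s t 0) (diffs (F s t)) by rw [mkV_diffs],
      segment_mkV, Ne, mkV_eq_zero_iff]
    rintro ⟨h1, h2⟩
    refine hseg s t τ hτ ?_ h2
    rw [← h1]
    ring
  · obtain ⟨Z, hZ, hZ'⟩ := exists_finset_of_not_injective (n := n)
      (S := {t : I | (diffs (mkV (F s t 0) fun i => denom t * polyEval (v s i) t) = 0) ∧
        denom t ≠ 0}) fun x hx => by
        have hs' : (fun j => (s j : ℝ)) ∈ {x : Fin k → ℝ | ∀ i, x i ∈ Set.Ioo (0 : ℝ) 1} := by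
          intro i
          by_contra h
          refine hs ⟨i, ?_⟩
          by_contra! h'
          exact h ⟨lt_of_le_of_ne (s i).2.1 fun e => h'.1 (Subtype.ext e.symm),
            lt_of_le_of_ne (s i).2.2 fun e => h'.2 (Subtype.ext e)⟩
        obtain ⟨i, j, hij⟩ := hz _ hs' (fun j => (x j : ℝ)) (Subtype.val_injective.comp hx)
        refine ⟨j, fun ⟨h1, h2⟩ => ?_⟩
        rw [diffs_mkV] at h1
        exact mul_ne_zero h2 hij (congrFun h1 i)
    exact ⟨Z, hZ, fun t h1 h2 => hZ' t ⟨h1, h2⟩⟩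

/-- Families over a cube of dimension at most `n (m - 1)` deform into `rat(n,m)`, through families
which stay in `rat(n,m)` over the boundary of the cube. -/
theorem exists_homotopicWith_ratOn {n k : ℕ} (hn : 1 ≤ n) (hm : 2 ≤ m) (hk : k ≤ n * (m - 1))
    {γ : C(Fin k → I, OmegaRP m)} (hγ : ∀ s, γ s ∈ signLoops n m)
    (hγB : RatOn n (Cube.boundary (Fin k)) γ) :
    ∃ γ' : C(Fin k → I, OmegaRP m), RatOn n Set.univ γ' ∧
      γ.HomotopicWith γ' (RatOn n (Cube.boundary (Fin k))) := by
  have hm1 : 1 ≤ m := one_le_two.trans hm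
  obtain ⟨F₀, hF₀, hB₀, h₀⟩ := exists_family_homotopicWith hn hm1 (isClosed_boundary k) hγ hγB
  obtain ⟨F₁, hF₁, hB₁, h₁, hfin⟩ := exists_few_zeros_homotopicWith hn hm hk hF₀ hB₀
  obtain ⟨r, hF₂, hB₂, h₂⟩ := exists_lead_homotopicWith hn hm1 hF₁ hB₁ hfin
  obtain ⟨F₃, hF₃, hB₃, h₃⟩ := exists_poly_homotopicWith hn hm1 hF₂ hB₂
  exact ⟨hF₃.loops, hF₃.loops_mem_ratSet hn hm1 hB₃, ((h₀.trans h₁).trans h₂).trans h₃⟩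

section PathConnected

variable {n : ℕ}

lemma isFamily_const {c₀ : Fin n → ℝ} {c : Fin m → Fin n → ℝ} (h : ∀ t, polyPath c₀ c t ≠ 0) :
    IsFamily n fun _ : Unit => polyPath c₀ c :=
  isFamily_polyPath continuous_const continuous_const fun _ => h

lemma joined_of_homotopicWith {T : Type*} [TopologicalSpace T] {γ γ' : C(T, OmegaRP m)}
    {P : C(T, OmegaRP m) → Prop} (h : γ.HomotopicWith γ' P) (s : T) : Joined (γ s) (γ' s) :=
  h.elim fun H => ⟨H.toHomotopy.evalAt s⟩

lemma joined_polyPath (hn : 1 ≤ n) (hm : 1 ≤ m) {c₀ c₀' : Fin n → ℝ} {c c' : Fin m → Fin n → ℝ}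
    (h : ∀ t, polyPath c₀ c t ≠ 0) (h' : ∀ t, polyPath c₀' c' t ≠ 0)
    (hseg : ∀ t, ∀ τ ∈ Set.Icc (0 : ℝ) 1, (1 - τ) * lead c₀ t + τ * lead c₀' t = 0 →
      ∃ i, (1 - τ) * (denom t * homog (c i) t) + τ * (denom t * homog (c' i) t) ≠ 0) :
    Joined ((isFamily_const h).loops ()) ((isFamily_const h').loops ()) := by
  refine joined_of_homotopicWith (homotopicWith_of_segment (B := ∅) hn hm _ _
    (fun _ h => h.elim) (fun _ h => h.elim) fun s t τ hτ h0 => ?_) ()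
  rw [polyPath, polyPath, segment_mkV, mkV_eq_zero_iff] at h0
  obtain ⟨i, hi⟩ := hseg t τ hτ h0.1
  exact hi (congrFun h0.2 i)

/-- Coefficients of the constant multiples `(1, y, …, y)` of a power of the denominator. -/
def slope (n : ℕ) (y : ℝ) (i : Fin m) (j : Fin n) : ℝ :=
  if (j : ℕ) = 0 then if (i : ℕ) = 0 then 1 else y else 0

lemma homog_slope (hn : 1 ≤ n) (y : ℝ) (i : Fin m) (t : I) :
    homog (slope n y i) t = (if (i : ℕ) = 0 then 1 else y) * denom t ^ (n - 1) := by
  rw [homog, Finset.sum_eq_single ⟨0, hn⟩]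
  · simp [slope]
  · intro j _ hj
    have : (j : ℕ) ≠ 0 := fun h => hj (Fin.ext h)
    simp [slope, this]
  · simp

lemma polyPath_slope_ne_zero (hn : 1 ≤ n) (hm : 1 ≤ m) (c₀ : Fin n → ℝ) (y : ℝ) (t : I) :
    polyPath c₀ (slope (m := m) n y) t ≠ 0 := by
  intro h
  rw [polyPath, mkV_eq_zero_iff] at h
  have h1 := congrFun h.2 ⟨0, hm⟩
  have h2 := denom_ne_zero_of_lead h.1
  simp [homog_slope hn, h2] at h1

lemma exists_finite_joined_slope (hn : 1 ≤ n) (hm : 2 ≤ m) {c₀ : Fin n → ℝ}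
    {c : Fin m → Fin n → ℝ} (h : ∀ t, polyPath c₀ c t ≠ 0) :
    ∃ S : Set ℝ, S.Finite ∧ ∀ y ∉ S, Joined ((isFamily_const h).loops ())
      ((isFamily_const (polyPath_slope_ne_zero hn (one_le_two.trans hm) c₀ y)).loops ()) := by
  obtain ⟨Z, -, hZ⟩ := exists_finset_lead_zeros c₀
  let i₀ : Fin m := ⟨0, one_pos.trans hm⟩
  let i₁ : Fin m := ⟨1, hm⟩
  refine ⟨(fun t => homog (c i₁) t / homog (c i₀) t) '' Z, Z.finite_toSet.image _,
    fun y hy => joined_polyPath hn (one_le_two.trans hm) h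
      (polyPath_slope_ne_zero hn (one_le_two.trans hm) c₀ y) fun t τ hτ h0 => ?_⟩
  have hl : lead c₀ t = 0 := by rw [← h0]; ring
  have hd := denom_ne_zero_of_lead hl
  have hd' : denom t ^ (n - 1) ≠ 0 := pow_ne_zero _ hd
  by_contra! hall
  have hall' : ∀ i, (1 - τ) * homog (c i) t + τ * homog (slope (m := m) n y i) t = 0 :=
    fun i => mul_left_cancel₀ hd (by linear_combination hall i)
  have h1 := hall' i₀
  have h2 := hall' i₁
  rw [homog_slope hn] at h1 h2
  simp only [i₀, i₁, if_true, one_ne_zero, if_false, one_mul] at h1 h2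
  by_cases hτ0 : τ = 0
  · refine h t ?_
    rw [polyPath, mkV_eq_zero_iff]
    refine ⟨hl, funext fun i => ?_⟩
    have h3 := hall' i
    simp only [hτ0, sub_zero, one_mul, zero_mul, add_zero] at h3
    simp [h3]
  · have h3 : homog (c i₀) t ≠ 0 := by
      intro h3
      simp only [i₀] at h3
      rw [h3, mul_zero, zero_add] at h1
      exact mul_ne_zero hτ0 hd' h1
    refine hy ⟨t, (hZ t).1 hl, ?_⟩
    have h4 : 1 - τ ≠ 0 := by
      intro h4
      rw [h4, zero_mul, zero_add] at h1
      exact mul_ne_zero hτ0 hd' h1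
    simp only
    rw [div_eq_iff h3]
    refine mul_left_cancel₀ h4 ?_
    linear_combination h2 - y * h1

/-- Any two loops in `rat(n,m)` lie in the same path component. -/
theorem joined_of_mem_ratSet (hn : 1 ≤ n) (hm : 2 ≤ m) {f g : OmegaRP m} (hf : f ∈ ratSet n m)
    (hg : g ∈ ratSet n m) : Joined f g := by
  have hm1 : 1 ≤ m := one_le_two.trans hm
  have key : ∀ f ∈ ratSet n m, ∃ (c₀ : Fin n → ℝ) (S : Set ℝ), S.Finite ∧ ∀ y ∉ S,
      Joined f ((isFamily_const (polyPath_slope_ne_zero hn hm1 c₀ y)).loops ()) := by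
    intro f hf
    obtain ⟨F, hF, hB, h⟩ := exists_family_homotopicWith (T := Unit) (γ := .const _ f) hn hm1
      isClosed_univ (fun _ => ratSet_subset_signLoops hn hf) (fun _ _ => hf)
    obtain ⟨c₀, c, hc⟩ := hB () trivial
    obtain rfl : F = fun _ => polyPath c₀ c := funext fun _ => hc
    obtain ⟨S, hS, hS'⟩ := exists_finite_joined_slope hn hm (hF.ne_zero ())
    exact ⟨c₀, S, hS, fun y hy => (joined_of_homotopicWith h ()).trans (hS' y hy)⟩
  obtain ⟨c₀, S, hS, hS'⟩ := key f hf
  obtain ⟨c₀', S', hS₁, hS₁'⟩ := key g hg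
  obtain ⟨y, hy⟩ := (hS.union hS₁).exists_notMem
  rw [Set.mem_union, not_or] at hy
  refine (hS' y hy.1).trans (Joined.trans ?_ (hS₁' y hy.2).symm)
  refine joined_polyPath hn hm1 (polyPath_slope_ne_zero hn hm1 c₀ y)
    (polyPath_slope_ne_zero hn hm1 c₀' y) fun t τ _ h0 => ⟨⟨0, hm1⟩, ?_⟩
  by_cases hd : denom t = 0
  · rw [lead_of_denom_eq_zero _ hd, lead_of_denom_eq_zero _ hd] at h0
    exact absurd (by linear_combination h0) (pow_ne_zero n (numer_ne_zero hd))
  · rw [homog_slope hn, ← add_mul, sub_add_cancel]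
    simp [hd]

lemma ratSet_nonempty (hn : 1 ≤ n) (hm : 1 ≤ m) : (ratSet n m).Nonempty :=
  ⟨_, (isFamily_const (polyPath_slope_ne_zero hn hm 0 0)).loops_mem_ratSet hn hm
    (B := Set.univ) (fun _ _ => ⟨_, _, rfl⟩) () trivial⟩

end PathConnected

section Compression

variable {k : ℕ}

/-- Twice the sup-distance to the centre of the cube. -/
def centreDist (y : Fin k → I) : ℝ := ‖fun i => 2 * (y i : ℝ) - 1‖

/-- Radial expansion of the cube from its centre by the inverse of a factor, cut off at the
boundary. -/
def expand (r : ℝ) (y : Fin k → I) (i : Fin k) : I :=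
  Set.projIcc 0 1 zero_le_one (1 / 2 + ((y i : ℝ) - 1 / 2) / r)

lemma expand_one (y : Fin k → I) : expand 1 y = y := by
  ext i
  have h : (1 / 2 + ((y i : ℝ) - 1 / 2) / 1) = y i := by ring
  rw [expand, h, Set.projIcc_val]

@[fun_prop] lemma continuous_centreDist : Continuous (centreDist (k := k)) := by
  unfold centreDist
  fun_prop

lemma centreDist_le_one (y : Fin k → I) : centreDist y ≤ 1 := by
  refine (pi_norm_le_iff_of_nonneg zero_le_one).2 fun i => ?_
  rw [Real.norm_eq_abs, abs_le]
  constructor <;> linarith [(y i).2.1, (y i).2.2]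

lemma centreDist_of_mem_boundary {y : Fin k → I} (hy : y ∈ Cube.boundary (Fin k)) :
    centreDist y = 1 := by
  refine (centreDist_le_one y).antisymm ?_
  obtain ⟨i, hi⟩ := hy
  have h := norm_le_pi_norm (fun i => 2 * (y i : ℝ) - 1) i
  refine le_trans (le_of_eq ?_) h
  rcases hi with hi | hi <;> norm_num [hi]

lemma expand_mem_boundary {y : Fin k → I} (hy : 0 < centreDist y) :
    expand (centreDist y) y ∈ Cube.boundary (Fin k) := by
  obtain ⟨i, hi⟩ : ∃ i, centreDist y ≤ |2 * (y i : ℝ) - 1| := by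
    by_contra! h
    exact lt_irrefl _ ((pi_norm_lt_iff hy).2 h)
  refine ⟨i, ?_⟩
  rcases le_abs.1 hi with h | h
  · refine Or.inr (Set.projIcc_of_right_le _ ?_)
    have : 1 / 2 ≤ ((y i : ℝ) - 1 / 2) / centreDist y := by
      rw [le_div_iff₀ hy]
      linarith
    linarith
  · refine Or.inl (Set.projIcc_of_le_left _ ?_)
    have : ((y i : ℝ) - 1 / 2) / centreDist y ≤ -(1 / 2) := by
      rw [div_le_iff₀ hy]
      linarith
    linarith

/-- A map of a cube which deforms into a set, through maps taking the boundary into that set,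
deforms into that set relative to the boundary. -/
theorem exists_homotopicRel_of_homotopicWith {X : Type*} [TopologicalSpace X] {A : Set X}
    {γ γ' : C(Fin k → I, X)} (hγ' : ∀ s, γ' s ∈ A)
    (h : γ.HomotopicWith γ' fun g => ∀ b ∈ Cube.boundary (Fin k), g b ∈ A) :
    ∃ γ'' : C(Fin k → I, X), (∀ s, γ'' s ∈ A) ∧
      γ.HomotopicRel γ'' (Cube.boundary (Fin k)) := by
  obtain ⟨H⟩ := h
  let Θ : I × (Fin k → I) → X := fun p =>
    H (Set.projIcc 0 1 zero_le_one ((p.1 : ℝ) * (2 - 2 * centreDist p.2)),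
      expand (max (1 - (p.1 : ℝ) / 2) (centreDist p.2)) p.2)
  have hΘ : Continuous Θ := by
    have hr : ∀ p : I × (Fin k → I), max (1 - (p.1 : ℝ) / 2) (centreDist p.2) ≠ 0 := fun p =>
      (lt_max_of_lt_left (by linarith [p.1.2.2])).ne'
    refine H.continuous.comp (Continuous.prodMk (continuous_projIcc.comp (by fun_prop))
      (continuous_pi fun i => continuous_projIcc.comp (continuous_const.add
        (Continuous.div (by fun_prop) (by fun_prop) hr))))
  have hΘ0 : ∀ y, Θ (0, y) = γ y := by
    intro y
    have h1 : max (1 - ((0 : I) : ℝ) / 2) (centreDist y) = 1 := by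
      simpa using centreDist_le_one y
    simp only [Θ, h1, expand_one]
    simp
  have hΘB : ∀ t, ∀ y ∈ Cube.boundary (Fin k), Θ (t, y) = γ y := by
    intro t y hy
    have h1 : max (1 - (t : ℝ) / 2) (centreDist y) = 1 := by
      rw [centreDist_of_mem_boundary hy]
      exact max_eq_right (by linarith [t.2.1])
    simp only [Θ, h1, expand_one]
    simp [centreDist_of_mem_boundary hy]
  refine ⟨⟨fun y => Θ (1, y), hΘ.comp (by fun_prop)⟩, fun y => ?_, ⟨{
    toFun := Θ
    continuous_toFun := hΘ
    map_zero_left := hΘ0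
    map_one_left := fun y => rfl
    prop' := fun t y hy => hΘB t y hy }⟩⟩
  simp only [ContinuousMap.coe_mk, Θ, Set.Icc.coe_one, one_mul]
  rcases le_total (centreDist y) (1 / 2) with hy | hy
  · rw [Set.projIcc_of_right_le _ (by linarith)]
    exact (H.apply_one _).symm ▸ hγ' _
  · rw [max_eq_right (by linarith)]
    exact H.prop _ _ (expand_mem_boundary (by linarith))

lemma homotopicRel_of_forall_mem {K X : Type*} [TopologicalSpace K] [TopologicalSpace X]
    {C : Set X} {S : Set K} {p q : C(K, C)} {p' q' : C(K, X)} (H : p'.HomotopyRel q' S)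
    (hp : ∀ s, (p s : X) = p' s) (hq : ∀ s, (q s : X) = q' s) (h : ∀ x, H x ∈ C) :
    p.HomotopicRel q S :=
  ⟨{  toFun := fun x => ⟨H x, h x⟩
      continuous_toFun := H.continuous.subtype_mk _
      map_zero_left := fun s => Subtype.ext ((H.apply_zero s).trans (hp s).symm)
      map_one_left := fun s => Subtype.ext ((H.apply_one s).trans (hq s).symm)
      prop' := fun t s hs => Subtype.ext ((H.eq_fst t hs).trans (hp s).symm) }⟩

/-- Every map of a cube into a path component taking the boundary into a subset can be deformed
into the subset, relative to the boundary. -/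
def Compressible {X : Type*} [TopologicalSpace X] (k : ℕ) (A C : Set X) : Prop :=
  ∀ γ : C(Fin k → I, X), (∀ s, γ s ∈ C) → (∀ b ∈ Cube.boundary (Fin k), γ b ∈ A) →
    ∃ γ' : C(Fin k → I, X), (∀ s, γ' s ∈ A) ∧ γ.HomotopicRel γ' (Cube.boundary (Fin k))

variable {X : Type*} [TopologicalSpace X] {A : Set X} {f₀ : X}

lemma surjective_piMap (hAC : A ⊆ pathComponent f₀) (h : Compressible k A (pathComponent f₀))
    (a : A) : Function.Surjective
      (piMap ⟨Set.inclusion hAC, continuous_inclusion hAC⟩ a k) := by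
  intro q
  induction q using Quotient.inductionOn with | _ q
  obtain ⟨γ', hγ', ⟨H⟩⟩ := h ⟨fun s => (q s : X), by fun_prop⟩ (fun s => (q s).2)
    (fun b hb => by
      have := q.2 b hb
      simp only [ContinuousMap.coe_mk]
      erw [this]
      exact a.2)
  let p : GenLoop (Fin k) A a := ⟨⟨fun s => ⟨γ' s, hγ' s⟩, by fun_prop⟩, fun b hb => by
    refine Subtype.ext ?_
    have h1 : H (1, b) = γ' b := H.apply_one b
    have h2 : H (1, b) = q b := H.eq_fst 1 hb
    have h3 := congrArg Subtype.val (q.2 b hb)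
    exact (h1.symm.trans h2).trans h3⟩
  refine ⟨Quotient.mk _ p, Quotient.sound (ContinuousMap.HomotopicRel.symm ?_)⟩
  refine homotopicRel_of_forall_mem H (fun s => rfl) (fun s => rfl) fun x => ?_
  have h1 : Joined (q x.2 : X) (H x) := by
    have h2 : (q x.2 : X) = H (0, x.2) := (H.apply_zero x.2).symm
    rw [h2]
    exact ⟨{ toFun := fun t => H (t * x.1, x.2)
             continuous_toFun := H.continuous.comp (by fun_prop)
             source' := by simp
             target' := by simp }⟩
  exact Joined.trans (q x.2).2 h1

lemma injective_piMap (hAC : A ⊆ pathComponent f₀)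
    (h : Compressible (k + 1) A (pathComponent f₀)) (a : A) : Function.Injective
      (piMap ⟨Set.inclusion hAC, continuous_inclusion hAC⟩ a k) := by
  intro p q
  induction p using Quotient.inductionOn with | _ p
  induction q using Quotient.inductionOn with | _ q
  intro hpq
  obtain ⟨H⟩ := Quotient.exact hpq
  have hH0 : ∀ y, (H (0, y) : X) = p y := fun y => congrArg Subtype.val (H.apply_zero y)
  have hH1 : ∀ y, (H (1, y) : X) = q y := fun y => congrArg Subtype.val (H.apply_one y)
  have hHB : ∀ t, ∀ y ∈ Cube.boundary (Fin k), (H (t, y) : X) = p y := fun t y hy =>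
    congrArg Subtype.val (H.eq_fst t hy)
  obtain ⟨γ', hγ', ⟨G⟩⟩ := h ⟨fun s => (H (s 0, Fin.tail s) : X),
    continuous_subtype_val.comp (H.continuous.comp
      ((continuous_apply 0).prodMk (continuous_pi fun i => continuous_apply i.succ)))⟩
    (fun s => (H _).2) (fun b hb => by
      obtain ⟨i, hi⟩ := hb
      simp only [ContinuousMap.coe_mk]
      induction i using Fin.cases with
      | zero =>
        rcases hi with hi | hi
        · rw [hi, hH0]
          exact (p _).2
        · rw [hi, hH1]
          exact (q _).2
      | succ i =>
        rw [hHB _ _ ⟨i, hi⟩]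
        exact (p _).2)
  have hG : ∀ s ∈ Cube.boundary (Fin (k + 1)), γ' s = H (s 0, Fin.tail s) := fun s hs =>
    (G.apply_one s).symm.trans (G.eq_fst 1 hs)
  refine Quotient.sound ⟨{
    toFun := fun x => ⟨γ' (Fin.cons x.1 x.2), hγ' _⟩
    continuous_toFun := ?_
    map_zero_left := fun y => Subtype.ext ?_
    map_one_left := fun y => Subtype.ext ?_
    prop' := fun t y hy => Subtype.ext ?_ }⟩
  · refine (γ'.continuous.comp (continuous_pi fun i => ?_)).subtype_mk _
    induction i using Fin.cases with
    | zero => exact continuous_fst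
    | succ i => exact (continuous_apply i).comp continuous_snd
  · exact (hG _ ⟨0, Or.inl rfl⟩).trans (hH0 y)
  · exact (hG _ ⟨0, Or.inr rfl⟩).trans (hH1 y)
  · obtain ⟨i, hi⟩ := hy
    exact (hG _ ⟨i.succ, hi⟩).trans (hHB t y ⟨i, hi⟩)

end Compression

lemma pathComponent_subset_signLoops {n : ℕ} {f₀ : OmegaRP m} (hf₀ : f₀ ∈ signLoops n m) :
    pathComponent f₀ ⊆ signLoops n m :=
  (pathComponent_subset_component f₀).trans
    ((isClopen_signLoops n).connectedComponent_subset hf₀)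

lemma compressible_ratSet {n k : ℕ} (hn : 1 ≤ n) (hm : 2 ≤ m) (hk : k ≤ n * (m - 1))
    {f₀ : OmegaRP m} (hf₀ : f₀ ∈ ratSet n m) :
    Compressible k (ratSet n m) (pathComponent f₀) := by
  intro γ hγ hγB
  obtain ⟨γ', hγ', h⟩ := exists_homotopicWith_ratOn hn hm hk
    (fun s => pathComponent_subset_signLoops (ratSet_subset_signLoops hn hf₀) (hγ s)) hγB
  exact exists_homotopicRel_of_homotopicWith (fun s => hγ' s trivial) h

end RatLoop

/-- For `m ≥ 2`, `n ≥ 1`: `rat(n,m)` is contained in a single path component `C` of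
`Ω ℝP^m`, and the inclusion `rat(n,m) ↪ C` induces, at any basepoint of `rat(n,m)`,
a bijection on homotopy groups `π_k` for `k < n(m−1)` and a surjection on `π_{n(m−1)}`. -/
theorem ratSet_approximates_loopSpace (n m : ℕ) (hn : 1 ≤ n) (hm : 2 ≤ m) :
    ∃ C : Set (OmegaRP m), (∃ f₀ : OmegaRP m, C = pathComponent f₀) ∧
      ∃ hsub : ratSet n m ⊆ C,
        ∀ f (hf : f ∈ ratSet n m),
          (∀ k : ℕ, k < n * (m - 1) →
            Function.Bijective
              (piMap ⟨Set.inclusion hsub, continuous_inclusion hsub⟩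
                (⟨f, hf⟩ : ↥(ratSet n m)) k)) ∧
          Function.Surjective
            (piMap ⟨Set.inclusion hsub, continuous_inclusion hsub⟩
              (⟨f, hf⟩ : ↥(ratSet n m)) (n * (m - 1))) := by
  obtain ⟨f₀, hf₀⟩ := RatLoop.ratSet_nonempty hn (one_le_two.trans hm)
  have hsub : ratSet n m ⊆ pathComponent f₀ := fun f hf =>
    RatLoop.joined_of_mem_ratSet hn hm hf₀ hf
  have hcomp : ∀ k ≤ n * (m - 1), RatLoop.Compressible k (ratSet n m) (pathComponent f₀) :=
    fun k hk => RatLoop.compressible_ratSet hn hm hk hf₀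
  exact ⟨pathComponent f₀, ⟨f₀, rfl⟩, hsub, fun f hf =>
    ⟨fun k hk => ⟨RatLoop.injective_piMap hsub (hcomp (k + 1) hk) ⟨f, hf⟩,
      RatLoop.surjective_piMap hsub (hcomp k hk.le) ⟨f, hf⟩⟩,
    RatLoop.surjective_piMap hsub (hcomp _ le_rfl) ⟨f, hf⟩⟩⟩

end
end

section
/- Let m ≥ 2, and let f ∈ RRat(n,m) and g ∈ RRat(n',m) for some n, n' ≥ 0. Then f and g lie in the same path component of Ω ℝP^m if and only if n ≡ n' (mod 2). -/
open OnePoint Projectivization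

noncomputable section

section Helpers

open Filter Topology Polynomial

/-! ### Points of `ℝP^m` and continuity on `ℝ ∪ {∞}` -/

/-- The class in `ℝP^m` of a vector, with junk value the basepoint at the zero vector. -/
def toRP {m : ℕ} (v : Fin (m + 1) → ℝ) : RP m :=
  if h : v ≠ 0 then Projectivization.mk ℝ v h else basept m

theorem toRP_of_ne_zero {m : ℕ} {v : Fin (m + 1) → ℝ} (h : v ≠ 0) :
    toRP v = Projectivization.mk ℝ v h := dif_pos h

theorem toRP_one (m : ℕ) : toRP (fun _ : Fin (m + 1) => (1 : ℝ)) = basept m :=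
  toRP_of_ne_zero _

theorem toRP_smul {m : ℕ} {c : ℝ} (hc : c ≠ 0) (v : Fin (m + 1) → ℝ) :
    toRP (c • v) = toRP v := by
  by_cases hv : v = 0
  · simp [hv]
  · rw [toRP_of_ne_zero hv, toRP_of_ne_zero (smul_ne_zero hc hv)]
    exact (Projectivization.mk_eq_mk_iff' ℝ _ _ _ _).2 ⟨c, rfl⟩

theorem exists_smul_eq_of_toRP_eq {m : ℕ} {v w : Fin (m + 1) → ℝ} (hv : v ≠ 0) (hw : w ≠ 0)
    (h : toRP v = toRP w) : ∃ c : ℝ, c • w = v := by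
  rw [toRP_of_ne_zero hv, toRP_of_ne_zero hw] at h
  exact (Projectivization.mk_eq_mk_iff' ℝ _ _ _ _).1 h

theorem continuousAt_toRP {m : ℕ} {v : Fin (m + 1) → ℝ} (hv : v ≠ 0) :
    ContinuousAt (toRP (m := m)) v := by
  have ho : IsOpenEmbedding (Subtype.val : {v : Fin (m + 1) → ℝ // v ≠ 0} → _) :=
    isOpen_ne.isOpenEmbedding_subtypeVal
  refine (ho.continuousAt_iff (x := ⟨v, hv⟩)).1 ?_
  have : (toRP (m := m)) ∘ (Subtype.val : {v : Fin (m + 1) → ℝ // v ≠ 0} → _) =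
      fun v => (Quotient.mk _ v : RP m) := by
    funext v
    exact toRP_of_ne_zero v.2
  rw [this]
  exact continuous_quotient_mk'.continuousAt

theorem continuous_elim_prod {T Y : Type*} [TopologicalSpace T] [TopologicalSpace Y] {y : Y}
    {F : T × ℝ → Y} (hF : Continuous F)
    (hy : ∀ t, Tendsto F (𝓝 t ×ˢ cocompact ℝ) (𝓝 y)) :
    Continuous fun z : T × OnePoint ℝ => z.2.elim y fun x => F (z.1, x) := by
  rw [continuous_iff_continuousAt]
  rintro ⟨t, x⟩
  induction x using OnePoint.rec with
  | infty =>
    rw [ContinuousAt, nhds_prod_eq, OnePoint.nhds_infty_eq, Filter.prod_sup, tendsto_sup,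
      Filter.prod_map_right, tendsto_map'_iff, Filter.prod_pure, tendsto_map'_iff,
      coclosedCompact_eq_cocompact]
    exact ⟨hy t, tendsto_const_nhds⟩
  | coe x =>
    rw [ContinuousAt, nhds_prod_eq, OnePoint.nhds_coe_eq, Filter.prod_map_right,
      tendsto_map'_iff, ← nhds_prod_eq]
    exact hF.continuousAt

/-! ### Monic tuples and the loops they represent -/

theorem tendsto_eval_div_pow_cocompact {p : ℝ[X]} (hp : p.Monic) :
    Tendsto (fun x => p.eval x / x ^ p.natDegree) (cocompact ℝ) (𝓝 1) := by
  have h0 : ∀ᶠ x in cocompact ℝ, x ≠ (0 : ℝ) := by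
    filter_upwards [(isCompact_singleton (x := (0 : ℝ))).compl_mem_cocompact] with x hx using hx
  have h1 : Tendsto (fun x : ℝ => p.reverse.eval x⁻¹) (cocompact ℝ) (𝓝 1) := by
    have h2 : p.reverse.eval 0 = 1 := by
      rw [← coeff_zero_eq_eval_zero, coeff_zero_reverse, hp]
    rw [← h2, ← Metric.cobounded_eq_cocompact]
    exact p.reverse.continuous.continuousAt.tendsto.comp tendsto_inv₀_cobounded
  refine h1.congr' ?_
  filter_upwards [h0] with x hx
  let := invertibleOfNonzero hx
  have := eval₂_reverse_mul_pow (RingHom.id ℝ) x p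
  rw [invOf_eq_inv] at this
  rw [eq_div_iff (pow_ne_zero _ hx)]
  exact this

/-- The vector of values at `x` of a tuple of polynomials. -/
def evalTuple {m : ℕ} (p : Fin (m + 1) → ℝ[X]) (x : ℝ) : Fin (m + 1) → ℝ :=
  fun i => (p i).eval x

theorem continuous_evalTuple {m : ℕ} (p : Fin (m + 1) → ℝ[X]) : Continuous (evalTuple p) :=
  continuous_pi fun i => (p i).continuous

/-- The tuples of monic polynomials of degree `n`. -/
structure IsMonicTuple {m : ℕ} (n : ℕ) (p : Fin (m + 1) → ℝ[X]) : Prop where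
  monic : ∀ i, (p i).Monic
  natDegree_eq : ∀ i, (p i).natDegree = n

theorem IsMonicTuple.tendsto {m n : ℕ} {p : Fin (m + 1) → ℝ[X]} (hp : IsMonicTuple n p) :
    Tendsto (fun x => (x ^ n)⁻¹ • evalTuple p x) (cocompact ℝ) (𝓝 fun _ => 1) := by
  refine tendsto_pi_nhds.2 fun i => ?_
  refine (tendsto_eval_div_pow_cocompact (hp.monic i)).congr fun x => ?_
  simp [evalTuple, hp.natDegree_eq i, div_eq_inv_mul]

theorem monic_X_sq_add_one : ((X : ℝ[X]) ^ 2 + 1).Monic :=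
  monic_X_pow_add_C (1 : ℝ) two_ne_zero

theorem natDegree_X_sq_add_one : ((X : ℝ[X]) ^ 2 + 1).natDegree = 2 :=
  natDegree_X_pow_add_C (n := 2) (r := (1 : ℝ))

/-- The loop `f` is given by the tuple `p`. -/
def Represents {m : ℕ} (p : Fin (m + 1) → ℝ[X]) (f : OmegaRP m) : Prop :=
  ∀ x : ℝ, evalTuple p x ≠ 0 ∧ f.1 (x : OnePoint ℝ) = toRP (evalTuple p x)

theorem Represents.unique {m : ℕ} {p : Fin (m + 1) → ℝ[X]} {f g : OmegaRP m}
    (hf : Represents p f) (hg : Represents p g) : f = g := by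
  refine Subtype.ext (ContinuousMap.ext fun x => ?_)
  induction x using OnePoint.rec with
  | infty => rw [f.2, g.2]
  | coe x => rw [(hf x).2, (hg x).2]

theorem exists_represents_of_mem_RRat {n m : ℕ} {f : OmegaRP m} (hf : f ∈ RRat n m) :
    ∃ p : Fin (m + 1) → ℝ[X], IsMonicTuple n p ∧ Represents p f := by
  obtain ⟨p, h1, h2, -, h3⟩ := hf
  refine ⟨p, ⟨h1, h2⟩, fun x => ?_⟩
  obtain ⟨hx, h⟩ := h3 x
  exact ⟨hx, h.trans (toRP_of_ne_zero hx).symm⟩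

/-- Multiplying all entries by `(X ^ 2 + 1) ^ k` does not change the loop. -/
theorem exists_represents_add_two_mul {n m : ℕ} {p : Fin (m + 1) → ℝ[X]} {f : OmegaRP m}
    (hp : IsMonicTuple n p) (hf : Represents p f) (k : ℕ) :
    ∃ q : Fin (m + 1) → ℝ[X], IsMonicTuple (n + 2 * k) q ∧ Represents q f := by
  have hk := monic_X_sq_add_one.pow k
  refine ⟨fun i => p i * (X ^ 2 + 1) ^ k, ⟨fun i => (hp.monic i).mul hk, fun i => ?_⟩,
    fun x => ?_⟩
  · rw [(hp.monic i).natDegree_mul hk, monic_X_sq_add_one.natDegree_pow,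
      natDegree_X_sq_add_one, hp.natDegree_eq]
    ring
  · have hc : (x ^ 2 + 1) ^ k ≠ 0 := by positivity
    have : evalTuple (fun i => p i * (X ^ 2 + 1) ^ k) x = (x ^ 2 + 1) ^ k • evalTuple p x := by
      funext i
      simp [evalTuple, mul_comm]
    rw [this, toRP_smul hc]
    exact ⟨smul_ne_zero hc (hf x).1, (hf x).2⟩

/-! ### Joining loops of the same degree -/

theorem exists_joined_of_convexCombination_ne_zero {n m : ℕ} {p q : Fin (m + 1) → ℝ[X]}
    (hp : IsMonicTuple n p) (hq : IsMonicTuple n q)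
    (h : ∀ t : ℝ, 0 ≤ t → t ≤ 1 → ∀ x, (1 - t) • evalTuple p x + t • evalTuple q x ≠ 0) :
    ∃ f g : OmegaRP m, Represents p f ∧ Represents q g ∧ Joined f g := by
  let V : unitInterval × ℝ → Fin (m + 1) → ℝ :=
    fun z => (1 - (z.1 : ℝ)) • evalTuple p z.2 + (z.1 : ℝ) • evalTuple q z.2
  have hV0 : ∀ z, V z ≠ 0 := fun z => h z.1 z.1.2.1 z.1.2.2 z.2
  have hVc : Continuous V := by
    have h1 := continuous_evalTuple p
    have h2 := continuous_evalTuple q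
    fun_prop
  have hlim (t : unitInterval) :
      Tendsto (fun z => toRP (V z)) (𝓝 t ×ˢ cocompact ℝ) (𝓝 (basept m)) := by
    have h1 : Tendsto (fun z : unitInterval × ℝ => (z.2 ^ n)⁻¹ • V z) (𝓝 t ×ˢ cocompact ℝ)
        (𝓝 fun _ => 1) := by
      have ht : Tendsto (fun z : unitInterval × ℝ => (z.1 : ℝ)) (𝓝 t ×ˢ cocompact ℝ)
          (𝓝 (t : ℝ)) := (continuous_subtype_val.tendsto t).comp tendsto_fst
      have := ((ht.const_sub 1).smul (hp.tendsto.comp tendsto_snd)).add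
        (ht.smul (hq.tendsto.comp tendsto_snd))
      refine (this.congr fun z => ?_).trans (le_of_eq ?_)
      · simp only [Function.comp, V, smul_add]
        rw [smul_comm (1 - (z.1 : ℝ)), smul_comm (z.1 : ℝ)]
      · congr 1
        funext i
        simp
    have hne : (fun _ : Fin (m + 1) => (1 : ℝ)) ≠ 0 := fun h => one_ne_zero (congrFun h 0)
    have h2 := (continuousAt_toRP hne).tendsto.comp h1
    rw [toRP_one] at h2
    refine h2.congr' ?_
    have h0 : ∀ᶠ x in cocompact ℝ, x ≠ (0 : ℝ) := by
      filter_upwards [(isCompact_singleton (x := (0 : ℝ))).compl_mem_cocompact] with x hx using hx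
    filter_upwards [h0.prod_inr (𝓝 t)] with z hz
    exact toRP_smul (inv_ne_zero (pow_ne_zero _ hz)) _
  let H : C(unitInterval × OnePoint ℝ, RP m) :=
    ⟨_, continuous_elim_prod (F := fun z => toRP (V z))
      (continuous_iff_continuousAt.2 fun z =>
        (continuousAt_toRP (hV0 z)).comp hVc.continuousAt) hlim⟩
  let γ : unitInterval → OmegaRP m := fun t => ⟨H.curry t, rfl⟩
  have hγ : Continuous γ := H.curry.continuous.subtype_mk _
  refine ⟨γ 0, γ 1, fun x => ⟨?_, ?_⟩, fun x => ⟨?_, ?_⟩, ⟨⟨⟨γ, hγ⟩, rfl, rfl⟩⟩⟩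
  · simpa [V] using hV0 (0, x)
  · change toRP (V (0, x)) = _
    simp [V]
  · simpa [V] using hV0 (1, x)
  · change toRP (V (1, x)) = _
    simp [V]

theorem dimH_range_smul_evalTuple_le {m : ℕ} (p : Fin (m + 1) → ℝ[X]) :
    dimH (Set.range fun z : ℝ × ℝ => z.1 • evalTuple p z.2) ≤ 2 := by
  have h : ContDiff ℝ 1 fun z : ℝ × ℝ => z.1 • evalTuple p z.2 := by
    refine contDiff_fst.smul (contDiff_pi.2 fun i => ?_)
    exact ((p i).contDiff_aeval (𝕜 := ℝ) 1).comp contDiff_snd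
  simpa using h.dimH_range_le

theorem exists_direction {m : ℕ} (hm : 2 ≤ m) (p q : Fin (m + 1) → ℝ[X]) :
    ∃ w : Fin (m + 1) → ℝ, 0 < w 0 ∧ w (Fin.last m) < 0 ∧
      (∀ (s : ℝ) x, s • evalTuple p x ≠ w) ∧ ∀ (s : ℝ) x, s • evalTuple q x ≠ w := by
  have hd : Dense ((Set.range fun z : ℝ × ℝ => z.1 • evalTuple p z.2) ∪
      Set.range fun z : ℝ × ℝ => z.1 • evalTuple q z.2)ᶜ := by
    refine dense_compl_of_dimH_lt_finrank ?_
    rw [dimH_union]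
    refine (max_le (dimH_range_smul_evalTuple_le p) (dimH_range_smul_evalTuple_le q)).trans_lt ?_
    rw [Module.finrank_fin_fun]
    exact_mod_cast (by omega : 2 < m + 1)
  have ho : IsOpen {w : Fin (m + 1) → ℝ | 0 < w 0 ∧ w (Fin.last m) < 0} :=
    (isOpen_lt continuous_const (continuous_apply _)).inter
      (isOpen_lt (continuous_apply _) continuous_const)
  have h0 : Fin.last m ≠ 0 := by
    rw [Ne, Fin.ext_iff, Fin.val_last, Fin.val_zero]
    omega
  obtain ⟨w, h1, h2⟩ := hd.exists_mem_open ho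
    ⟨fun i => if i = 0 then 1 else -1, by simp [h0]⟩
  exact ⟨w, h2.1, h2.2, fun s x h => h1 (.inl ⟨(s, x), h⟩), fun s x h => h1 (.inr ⟨(s, x), h⟩)⟩

theorem IsMonicTuple.add_const {n m : ℕ} {p : Fin (m + 1) → ℝ[X]} (hp : IsMonicTuple n p)
    (hn : n ≠ 0) (w : Fin (m + 1) → ℝ) : IsMonicTuple n fun i => p i + C (w i) := by
  refine ⟨fun i => (hp.monic i).add_of_left ?_, fun i => ?_⟩
  · refine degree_C_le.trans_lt (natDegree_pos_iff_degree_pos.1 ?_)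
    rw [hp.natDegree_eq]
    exact Nat.pos_of_ne_zero hn
  · rw [natDegree_add_C, hp.natDegree_eq]

theorem evalTuple_add_const {m : ℕ} (p : Fin (m + 1) → ℝ[X]) (w : Fin (m + 1) → ℝ) (x : ℝ) :
    evalTuple (fun i => p i + C (w i)) x = evalTuple p x + w := by
  funext i
  simp [evalTuple]

theorem convexCombination_add_const_ne_zero {m : ℕ} {p : Fin (m + 1) → ℝ[X]}
    {w : Fin (m + 1) → ℝ} (hp : ∀ x, evalTuple p x ≠ 0)
    (hw : ∀ (s : ℝ) x, s • evalTuple p x ≠ w) (c t x : ℝ) :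
    (1 - t) • evalTuple p x + t • evalTuple (fun i => p i + C ((c • w) i)) x ≠ 0 := by
  rw [evalTuple_add_const]
  intro h
  have h1 : evalTuple p x + (t * c) • w = 0 := by
    rw [← h, mul_smul, smul_add, sub_smul, one_smul]
    abel
  by_cases ht : t * c = 0
  · rw [ht, zero_smul, add_zero] at h1
    exact hp x h1
  · refine hw (-(t * c)⁻¹) x ?_
    rw [eq_neg_of_add_eq_zero_left h1, smul_neg, neg_smul, neg_neg, smul_smul,
      inv_mul_cancel₀ ht, one_smul]

theorem IsMonicTuple.eventually_pos {n m : ℕ} {p : Fin (m + 1) → ℝ[X]}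
    (hp : IsMonicTuple n p) (i : Fin (m + 1)) :
    ∀ᶠ x in cocompact ℝ, 0 < (x ^ n)⁻¹ * (p i).eval x :=
  (tendsto_pi_nhds.1 hp.tendsto i).eventually (lt_mem_nhds one_pos)

theorem exists_convexCombination_add_const_ne_zero {n m : ℕ} {p q : Fin (m + 1) → ℝ[X]}
    (hp : IsMonicTuple n p) (hq : IsMonicTuple n q) {w : Fin (m + 1) → ℝ} {i j : Fin (m + 1)}
    (hi : 0 < w i) (hj : w j < 0) :
    ∃ c : ℝ, ∀ t : ℝ, 0 ≤ t → t ≤ 1 → ∀ x,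
      (1 - t) • evalTuple (fun i => p i + C ((c • w) i)) x +
        t • evalTuple (fun i => q i + C ((c • w) i)) x ≠ 0 := by
  have hE : ∀ᶠ x in cocompact ℝ, (0 < (p i).eval x ∧ 0 < (q i).eval x) ∨
      ((p j).eval x < 0 ∧ (q j).eval x < 0) := by
    filter_upwards [hp.eventually_pos i, hq.eventually_pos i, hp.eventually_pos j,
      hq.eventually_pos j] with x h1 h2 h3 h4
    rcases lt_or_ge 0 (x ^ n)⁻¹ with h | h
    · exact .inl ⟨(mul_pos_iff_of_pos_left h).1 h1, (mul_pos_iff_of_pos_left h).1 h2⟩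
    · exact .inr ⟨neg_of_mul_pos_right h3 h, neg_of_mul_pos_right h4 h⟩
  obtain ⟨K, hK, hKE⟩ := mem_cocompact.1 hE
  obtain ⟨A, hA⟩ := hK.exists_bound_of_continuousOn (p i).continuous.continuousOn
  obtain ⟨B, hB⟩ := hK.exists_bound_of_continuousOn (q i).continuous.continuousOn
  refine ⟨(|A| + |B| + 1) / w i, fun t ht0 ht1 x h => ?_⟩
  set c := (|A| + |B| + 1) / w i with hc
  have hc0 : 0 < c := by positivity
  have hcw : c * w i = |A| + |B| + 1 := div_mul_cancel₀ _ hi.ne'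
  have key (k : Fin (m + 1)) : (1 - t) * (p k).eval x + t * (q k).eval x + c * w k = 0 := by
    have := congrFun h k
    simp only [evalTuple, Pi.add_apply, Pi.smul_apply, smul_eq_mul, eval_add, eval_C,
      Pi.zero_apply] at this
    linarith
  have hki := key i
  have hkj := key j
  have hcj : c * w j < 0 := mul_neg_of_pos_of_neg hc0 hj
  have hA0 := abs_nonneg A
  have hB0 := abs_nonneg B
  by_cases hx : x ∈ K
  · have h1 := (abs_le.1 ((hA x hx).trans (le_abs_self A))).1
    have h2 := (abs_le.1 ((hB x hx).trans (le_abs_self B))).1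
    nlinarith
  · rcases hKE hx with ⟨h1, h2⟩ | ⟨h1, h2⟩
    · nlinarith [mul_nonneg (sub_nonneg.2 ht1) h1.le, mul_nonneg ht0 h2.le]
    · nlinarith [mul_nonneg (sub_nonneg.2 ht1) (neg_pos.2 h1).le,
        mul_nonneg ht0 (neg_pos.2 h2).le]

theorem joined_of_represents {n m : ℕ} (hm : 2 ≤ m) (hn : n ≠ 0) {p q : Fin (m + 1) → ℝ[X]}
    (hp : IsMonicTuple n p) (hq : IsMonicTuple n q) {f g : OmegaRP m}
    (hf : Represents p f) (hg : Represents q g) : Joined f g := by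
  obtain ⟨w, hi, hj, hwp, hwq⟩ := exists_direction hm p q
  obtain ⟨c, hpq⟩ := exists_convexCombination_add_const_ne_zero hp hq hi hj
  obtain ⟨f₁, f₂, hf₁, hf₂, hf₁₂⟩ := exists_joined_of_convexCombination_ne_zero hp
    (hp.add_const hn (c • w)) fun t _ _ x =>
      convexCombination_add_const_ne_zero (fun x => (hf x).1) hwp c t x
  obtain ⟨g₁, g₂, hg₁, hg₂, hg₁₂⟩ := exists_joined_of_convexCombination_ne_zero hq
    (hq.add_const hn (c • w)) fun t _ _ x =>
      convexCombination_add_const_ne_zero (fun x => (hg x).1) hwq c t x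
  obtain ⟨f₃, g₃, hf₃, hg₃, hfg₃⟩ := exists_joined_of_convexCombination_ne_zero
    (hp.add_const hn (c • w)) (hq.add_const hn (c • w)) hpq
  rw [hf.unique hf₁, hg.unique hg₁]
  rw [hf₃.unique hf₂, hg₃.unique hg₂] at hfg₃
  exact (hf₁₂.trans hfg₃).trans hg₁₂.symm

/-! ### Loops that lift to nonvanishing vectors -/

/-- The loop lifts to a continuous nowhere zero map `ℝ ∪ {∞} → ℝ^{m+1}`. -/
def Lifts {m : ℕ} (f : OmegaRP m) : Prop :=
  ∃ u : OnePoint ℝ → Fin (m + 1) → ℝ, Continuous u ∧ ∀ x, u x ≠ 0 ∧ toRP (u x) = f.1 x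

/-- The orthogonal projection onto a line, as a matrix. -/
def projMatrix {m : ℕ} (l : RP m) : Matrix (Fin (m + 1)) (Fin (m + 1)) ℝ :=
  Projectivization.lift
    (fun v => (v.1 ⬝ᵥ v.1)⁻¹ • Matrix.vecMulVec v.1 v.1)
    (by
      rintro ⟨a, ha⟩ ⟨b, hb⟩ t (rfl : a = t • b)
      have ht : t ≠ 0 := by
        rintro rfl
        exact ha (zero_smul _ _)
      ext i j
      simp only [Matrix.smul_apply, Matrix.vecMulVec_apply, Pi.smul_apply, smul_eq_mul,
        dotProduct_smul, smul_dotProduct]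
      field_simp) l

theorem projMatrix_toRP {m : ℕ} {v : Fin (m + 1) → ℝ} (hv : v ≠ 0) :
    projMatrix (toRP v) = (v ⬝ᵥ v)⁻¹ • Matrix.vecMulVec v v := by
  rw [toRP_of_ne_zero hv]
  rfl

theorem continuous_projMatrix {m : ℕ} : Continuous (projMatrix (m := m)) := by
  suffices h : Continuous fun v : {v : Fin (m + 1) → ℝ // v ≠ 0} =>
      (v.1 ⬝ᵥ v.1)⁻¹ • Matrix.vecMulVec v.1 v.1 from
    continuous_quot_lift _ h
  have hval : Continuous fun v : {v : Fin (m + 1) → ℝ // v ≠ 0} => v.1 := continuous_subtype_val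
  exact ((hval.dotProduct hval).inv₀ fun v => dotProduct_self_eq_zero.not.2 v.2).smul
    (hval.matrix_vecMulVec hval)

theorem projMatrix_toRP_mulVec {m : ℕ} {v : Fin (m + 1) → ℝ} (hv : v ≠ 0)
    (w : Fin (m + 1) → ℝ) :
    (projMatrix (toRP v)).mulVec w = ((v ⬝ᵥ v)⁻¹ * (v ⬝ᵥ w)) • v := by
  rw [projMatrix_toRP hv, Matrix.smul_mulVec, Matrix.vecMulVec_mulVec, mul_smul]
  simp

theorem exists_toRP_eq {m : ℕ} (l : RP m) : ∃ v : Fin (m + 1) → ℝ, v ≠ 0 ∧ toRP v = l :=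
  ⟨l.rep, l.rep_nonzero, (toRP_of_ne_zero l.rep_nonzero).trans l.mk_rep⟩

theorem trace_projMatrix_mul {m : ℕ} {v w : Fin (m + 1) → ℝ} (hv : v ≠ 0) (hw : w ≠ 0) :
    (projMatrix (toRP v) * projMatrix (toRP w)).trace =
      (v ⬝ᵥ v)⁻¹ * (w ⬝ᵥ w)⁻¹ * (v ⬝ᵥ w) ^ 2 := by
  rw [projMatrix_toRP hv, projMatrix_toRP hw, Matrix.smul_mul, Matrix.mul_smul,
    Matrix.trace_smul, Matrix.trace_smul, Matrix.vecMulVec_mul_vecMulVec,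
    Matrix.trace_vecMulVec, dotProduct_smul]
  simp only [smul_eq_mul]
  ring

/-- Liftability passes to every loop that is nowhere orthogonal to the given one. -/
theorem Lifts.of_trace_ne_zero {m : ℕ} {f g : OmegaRP m} (hf : Lifts f)
    (h : ∀ x, (projMatrix (f.1 x) * projMatrix (g.1 x)).trace ≠ 0) : Lifts g := by
  obtain ⟨u, hu, huf⟩ := hf
  refine ⟨fun x => (projMatrix (g.1 x)).mulVec (u x),
    (continuous_projMatrix.comp g.1.continuous).matrix_mulVec hu, fun x => ?_⟩
  obtain ⟨v, hv, hvg⟩ := exists_toRP_eq (g.1 x)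
  have hx := h x
  rw [← (huf x).2, ← hvg, trace_projMatrix_mul (huf x).1 hv] at hx
  have hc : (v ⬝ᵥ v)⁻¹ * (v ⬝ᵥ u x) ≠ 0 := by
    refine mul_ne_zero (inv_ne_zero (dotProduct_self_eq_zero.not.2 hv)) fun h0 => hx ?_
    rw [dotProduct_comm (u x) v, h0]
    simp
  beta_reduce
  rw [← hvg, projMatrix_toRP_mulVec hv, toRP_smul hc]
  exact ⟨smul_ne_zero hc hv, rfl⟩

theorem eventually_lifts_iff {m : ℕ} (f : OmegaRP m) : ∀ᶠ g in 𝓝 f, Lifts g ↔ Lifts f := by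
  have hcont : Continuous fun z : OmegaRP m × OnePoint ℝ =>
      (projMatrix (f.1 z.2) * projMatrix (z.1.1 z.2)).trace := by
    have h1 : Continuous fun z : OmegaRP m × OnePoint ℝ => f.1 z.2 :=
      f.1.continuous.comp continuous_snd
    have h2 : Continuous fun z : OmegaRP m × OnePoint ℝ => z.1.1 z.2 :=
      (continuous_subtype_val.comp continuous_fst).eval continuous_snd
    exact ((continuous_projMatrix.comp h1).matrix_mul
      (continuous_projMatrix.comp h2)).matrix_trace
  have hdiag (x : OnePoint ℝ) : (projMatrix (f.1 x) * projMatrix (f.1 x)).trace ≠ 0 := by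
    obtain ⟨v, hv, hvf⟩ := exists_toRP_eq (f.1 x)
    have h0 : v ⬝ᵥ v ≠ 0 := dotProduct_self_eq_zero.not.2 hv
    rw [← hvf, trace_projMatrix_mul hv hv]
    positivity
  have hev : ∀ᶠ g in 𝓝 f, ∀ x ∈ (Set.univ : Set (OnePoint ℝ)),
      (projMatrix (f.1 x) * projMatrix (g.1 x)).trace ≠ 0 :=
    isCompact_univ.eventually_forall_of_forall_eventually fun x _ =>
      hcont.continuousAt.eventually_ne (hdiag x)
  filter_upwards [hev] with g hg
  refine ⟨fun h => h.of_trace_ne_zero fun x => ?_,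
    fun h => h.of_trace_ne_zero fun x => hg x trivial⟩
  rw [Matrix.trace_mul_comm]
  exact hg x trivial

theorem lifts_iff_of_joined {m : ℕ} {f g : OmegaRP m} (h : Joined f g) :
    Lifts f ↔ Lifts g := by
  obtain ⟨γ⟩ := h
  have hl : IsLocallyConstant (Lifts (m := m)) := (IsLocallyConstant.iff_eventually_eq _).2
    fun f => (eventually_lifts_iff f).mono fun _ h => propext h
  have := (hl.comp_continuous γ.continuous).apply_eq_of_preconnectedSpace 0 1
  simpa using this

theorem lifts_of_even {n m : ℕ} {p : Fin (m + 1) → ℝ[X]} {f : OmegaRP m}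
    (hp : IsMonicTuple n p) (hf : Represents p f) (hn : Even n) : Lifts f := by
  obtain ⟨k, rfl⟩ := hn
  have hq : ((X ^ 2 + 1 : ℝ[X]) ^ k).Monic := monic_X_sq_add_one.pow k
  have hqd : ((X ^ 2 + 1 : ℝ[X]) ^ k).natDegree = k + k := by
    rw [monic_X_sq_add_one.natDegree_pow, natDegree_X_sq_add_one]
    ring
  have hpos (x : ℝ) : 0 < (x ^ 2 + 1) ^ k := by positivity
  have hlim : Tendsto (fun x : ℝ => ((x ^ 2 + 1) ^ k)⁻¹ • evalTuple p x) (cocompact ℝ)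
      (𝓝 fun _ => 1) := by
    have h1 := ((tendsto_eval_div_pow_cocompact hq).inv₀ one_ne_zero).smul hp.tendsto
    rw [inv_one, one_smul, hqd] at h1
    refine h1.congr' ?_
    filter_upwards [(isCompact_singleton (x := (0 : ℝ))).compl_mem_cocompact] with x hx
    have hx0 : x ^ (k + k) ≠ 0 := pow_ne_zero _ hx
    rw [smul_smul]
    congr 1
    simp only [eval_pow, eval_add, eval_X, eval_one]
    field_simp
  have hc : Continuous fun x : ℝ => ((x ^ 2 + 1) ^ k)⁻¹ • evalTuple p x :=
    (Continuous.inv₀ (by fun_prop) fun x => (hpos x).ne').smul (continuous_evalTuple p)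
  have hu := continuous_elim_prod (T := Unit) (hc.comp continuous_snd)
    fun _ => hlim.comp tendsto_snd
  refine ⟨fun x => x.elim (fun _ => 1) fun x => ((x ^ 2 + 1) ^ k)⁻¹ • evalTuple p x,
    hu.comp (Continuous.prodMk_right ()), fun x => ?_⟩
  induction x using OnePoint.rec with
  | infty => exact ⟨fun h => one_ne_zero (congrFun h 0), (toRP_one m).trans f.2.symm⟩
  | coe x =>
    have h0 := inv_ne_zero (hpos x).ne'
    exact ⟨smul_ne_zero h0 (hf x).1, (toRP_smul h0 _).trans (hf x).2.symm⟩

theorem not_lifts_of_odd {n m : ℕ} {p : Fin (m + 1) → ℝ[X]} {f : OmegaRP m}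
    (hp : IsMonicTuple n p) (hf : Represents p f) (hn : Odd n) : ¬ Lifts f := by
  rintro ⟨u, hu, huf⟩
  let G : ℝ → ℝ := fun x => u x ⬝ᵥ evalTuple p x
  have hG : Continuous G :=
    (hu.comp OnePoint.continuous_coe).dotProduct (continuous_evalTuple p)
  have hG0 (x : ℝ) : G x ≠ 0 := by
    obtain ⟨c, hc⟩ := exists_smul_eq_of_toRP_eq (huf x).1 (hf x).1
      ((huf x).2.trans (hf x).2)
    have hc0 : c ≠ 0 := by
      rintro rfl
      exact (huf x).1 (by rw [← hc, zero_smul])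
    change u x ⬝ᵥ evalTuple p x ≠ 0
    rw [← hc, smul_dotProduct]
    exact mul_ne_zero hc0 (dotProduct_self_eq_zero.not.2 (hf x).1)
  have hone : (fun _ : Fin (m + 1) => (1 : ℝ)) ≠ 0 := fun h => one_ne_zero (congrFun h 0)
  obtain ⟨a, ha⟩ := exists_smul_eq_of_toRP_eq (huf ∞).1 hone
    (((huf ∞).2.trans f.2).trans (toRP_one m).symm)
  have hL0 : u ∞ ⬝ᵥ (fun _ => (1 : ℝ)) ≠ 0 := by
    have ha0 : a ≠ 0 := by
      rintro rfl
      exact (huf ∞).1 (by rw [← ha, zero_smul])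
    rw [← ha, smul_dotProduct]
    exact mul_ne_zero ha0 (dotProduct_self_eq_zero.not.2 hone)
  have hlim : Tendsto (fun x : ℝ => (x ^ n)⁻¹ * G x) (cocompact ℝ)
      (𝓝 (u ∞ ⬝ᵥ fun _ => (1 : ℝ))) := by
    have h1 : Tendsto (fun x : ℝ => u x) (cocompact ℝ) (𝓝 (u ∞)) := by
      have := (hu.tendsto ∞).mono_left (le_sup_left.trans_eq OnePoint.nhds_infty_eq.symm)
      rwa [tendsto_map'_iff, coclosedCompact_eq_cocompact] at this
    have h2 : Continuous fun z : (Fin (m + 1) → ℝ) × (Fin (m + 1) → ℝ) => z.1 ⬝ᵥ z.2 :=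
      continuous_fst.dotProduct continuous_snd
    refine ((h2.tendsto (u ∞, fun _ => 1)).comp (h1.prodMk_nhds hp.tendsto)).congr fun x => ?_
    simp [G, dotProduct_smul]
  rw [cocompact_eq_atBot_atTop, tendsto_sup] at hlim
  have hprod := hlim.2.mul (hlim.1.comp tendsto_neg_atTop_atBot)
  obtain ⟨x, hx, hx0⟩ := ((hprod.eventually (lt_mem_nhds (mul_self_pos.2 hL0))).and
    (eventually_gt_atTop 0)).exists
  simp only [Function.comp, hn.neg_pow] at hx
  have hneg : G x * G (-x) < 0 := by
    have hxn : 0 < (x ^ n)⁻¹ ^ 2 := by positivity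
    have : (x ^ n)⁻¹ * G x * ((-x ^ n)⁻¹ * G (-x)) = (x ^ n)⁻¹ ^ 2 * -(G x * G (-x)) := by
      rw [inv_neg]
      ring
    rw [this, mul_pos_iff_of_pos_left hxn] at hx
    linarith
  have hzero : (0 : ℝ) ∈ Set.range G := by
    rcases mul_neg_iff.1 hneg with ⟨h1, h2⟩ | ⟨h1, h2⟩
    · exact mem_range_of_exists_le_of_exists_ge hG ⟨_, h2.le⟩ ⟨_, h1.le⟩
    · exact mem_range_of_exists_le_of_exists_ge hG ⟨_, h1.le⟩ ⟨_, h2.le⟩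
  obtain ⟨y, hy⟩ := hzero
  exact hG0 y hy

theorem lifts_iff_even {n m : ℕ} {p : Fin (m + 1) → ℝ[X]} {f : OmegaRP m}
    (hp : IsMonicTuple n p) (hf : Represents p f) : Lifts f ↔ Even n :=
  ⟨fun h => by_contra fun hn => not_lifts_of_odd hp hf (Nat.not_even_iff_odd.1 hn) h,
    lifts_of_even hp hf⟩

end Helpers

/-- For `m ≥ 2`, loops `f ∈ RRat(n,m)` and `g ∈ RRat(n',m)` lie in the same path component
of `Ω ℝP^m` if and only if `n ≡ n' (mod 2)`. -/
theorem rrat_joined_iff_parity (m n n' : ℕ) (hm : 2 ≤ m)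
    (f g : OmegaRP m) (hf : f ∈ RRat n m) (hg : g ∈ RRat n' m) :
    Joined f g ↔ n % 2 = n' % 2 := by
  obtain ⟨p, hp, hpf⟩ := exists_represents_of_mem_RRat hf
  obtain ⟨q, hq, hqg⟩ := exists_represents_of_mem_RRat hg
  constructor
  · intro h
    have := lifts_iff_of_joined h
    rw [lifts_iff_even hp hpf, lifts_iff_even hq hqg, Nat.even_iff, Nat.even_iff] at this
    omega
  · intro h
    obtain ⟨a, b, hab, ha⟩ : ∃ a b, n' + 2 * b = n + 2 * a ∧ n + 2 * a ≠ 0 :=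
      ⟨n' + 1, (n - n') / 2 + (n' + 1) - (n' - n) / 2, by omega, by omega⟩
    obtain ⟨p', hp', hpf'⟩ := exists_represents_add_two_mul hp hpf a
    obtain ⟨q', hq', hqg'⟩ := exists_represents_add_two_mul hq hqg b
    exact joined_of_represents hm ha hp' (hab ▸ hq') hpf' hqg'

end
end
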